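/- arXiv:1205.4659 — 2 statements merged into one kernel-verified Lean document; each statement's English description precedes it below -/
import Mathlib

section
/- Let τ be a strictly convex norm on ℝ² and M ∈ ℕ. For every δ₂ > 0 there exists κ₂ > 0, depending only on δ₂, M and τ, such that for every m > 0, every set E ⊆ ∂Q_m with |E| ≤ M, every partition E̲ of E, and every S ∈ Ω_{E̲} each of whose connected components contains a point of E: if τ(S) ≤ τ_{E̲} + κ₂ m, then there exists F ∈ Ω^min_{M,m} with d_τ(S, F) < δ₂ m. -/
open scoped ENNReal

/-- The plane `ℝ²`. -/
abbrev P2 : Type := ℝ × ℝ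

/-- `τ : ℝ² → ℝ` is a norm. -/
structure IsNorm (τ : P2 → ℝ) : Prop where
  eq_zero_iff : ∀ x : P2, τ x = 0 ↔ x = 0
  smul_eq : ∀ (c : ℝ) (x : P2), τ (c • x) = |c| * τ x
  add_le : ∀ x y : P2, τ (x + y) ≤ τ x + τ y

/-- `τ` is a strictly convex norm: `τ(x+y) < τ(x)+τ(y)` whenever `x` and `y` are not
nonnegative multiples of one another. -/
def IsStrictlyConvexNorm (τ : P2 → ℝ) : Prop :=
  IsNorm τ ∧ ∀ x y : P2, ¬ (∃ c : ℝ, 0 ≤ c ∧ (x = c • y ∨ y = c • x)) →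
    τ (x + y) < τ x + τ y

/-- The `τ`-diameter of a set (in `ℝ≥0∞`). -/
noncomputable def tauDiam (τ : P2 → ℝ) (A : Set P2) : ℝ≥0∞ :=
  ⨆ x ∈ A, ⨆ y ∈ A, ENNReal.ofReal (τ (x - y))

/-- The one-dimensional Hausdorff measure of `S` computed in the metric
`(x,y) ↦ τ(x−y)`: `lim_{ε→0} inf {Σ diam_τ(Aᵢ) : S ⊆ ⋃ Aᵢ, diam_τ(Aᵢ) ≤ ε}`. -/
noncomputable def tauLen (τ : P2 → ℝ) (S : Set P2) : ℝ≥0∞ :=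
  ⨆ (ε : ℝ) (_ : 0 < ε),
    ⨅ (A : ℕ → Set P2) (_ : S ⊆ ⋃ i, A i)
      (_ : ∀ i, tauDiam τ (A i) ≤ ENNReal.ofReal ε),
      ∑' i, tauDiam τ (A i)

/-- `Ep` (a family `E₁,…,E_r`) is a partition of `E`: nonempty, pairwise disjoint pieces
whose union is `E`. -/
def IsPartitionOf {r : ℕ} (Ep : Fin r → Set P2) (E : Set P2) : Prop :=
  (∀ j, (Ep j).Nonempty) ∧ (∀ j k, j ≠ k → Disjoint (Ep j) (Ep k)) ∧ (⋃ j, Ep j) = E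

/-- `Ω_{E̲}`: compact sets `S` such that each `E_j` is contained in a single connected
component of `S`. -/
def OmegaSet {r : ℕ} (Ep : Fin r → Set P2) : Set (Set P2) :=
  {S | IsCompact S ∧ ∀ j, ∃ x ∈ S, Ep j ⊆ connectedComponentIn S x}

/-- `τ_{E̲} = inf {τ(S) : S ∈ Ω_{E̲}}`. -/
noncomputable def tauMin (τ : P2 → ℝ) {r : ℕ} (Ep : Fin r → Set P2) : ℝ≥0∞ :=
  ⨅ S ∈ OmegaSet Ep, tauLen τ S

/-- `Ω^min_{E̲}`: the Steiner forests of `E̲`. -/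
def OmegaMinSet (τ : P2 → ℝ) {r : ℕ} (Ep : Fin r → Set P2) : Set (Set P2) :=
  {S ∈ OmegaSet Ep | tauLen τ S = tauMin τ Ep}

/-- The box `Q_m = [−m,m]² ⊂ ℝ²`. -/
def Qbox (m : ℝ) : Set P2 := Set.Icc (-m) m ×ˢ Set.Icc (-m) m

/-- `Ω^min_{M,m}`: all Steiner forests `F ∈ Ω^min_{E̲}`, over `E ⊆ ∂Q_m` with `|E| ≤ M` and
partitions `E̲` of `E`, each of whose connected components contains a point of `E`. -/
def OmegaMinMm (τ : P2 → ℝ) (M : ℕ) (m : ℝ) : Set (Set P2) :=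
  {F | ∃ (E : Set P2) (r : ℕ) (Ep : Fin r → Set P2),
    E ⊆ frontier (Qbox m) ∧ E.Finite ∧ E.ncard ≤ M ∧ IsPartitionOf Ep E ∧
    F ∈ OmegaMinSet τ Ep ∧ ∀ x ∈ F, (connectedComponentIn F x ∩ E).Nonempty}

/-- The `τ`-Hausdorff "distance" `d_τ(A,B) = sup_{a∈A} inf_{b∈B} τ(a−b)` (in `ℝ≥0∞`). -/
noncomputable def dTau (τ : P2 → ℝ) (A B : Set P2) : ℝ≥0∞ :=
  ⨆ a ∈ A, ⨅ b ∈ B, ENNReal.ofReal (τ (a - b))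



/-! ### Basic facts on norms -/

lemma IsNorm.nonneg {τ : P2 → ℝ} (h : IsNorm τ) (x : P2) : 0 ≤ τ x := by
  have h1 := h.add_le x (-x)
  have h2 := h.smul_eq (-1) x
  have h3 := (h.eq_zero_iff 0).2 rfl
  simp at h1 h2
  rw [h2, h3] at h1
  linarith

lemma IsNorm.zero {τ : P2 → ℝ} (h : IsNorm τ) : τ 0 = 0 := (h.eq_zero_iff 0).2 rfl

lemma IsNorm.sub_comm {τ : P2 → ℝ} (h : IsNorm τ) (x y : P2) : τ (x - y) = τ (y - x) := by
  have h2 := h.smul_eq (-1) (y - x)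
  simpa using h2

lemma IsNorm.tri {τ : P2 → ℝ} (h : IsNorm τ) (x y z : P2) :
    τ (x - z) ≤ τ (x - y) + τ (y - z) := by
  have := h.add_le (x - y) (y - z)
  simpa using this

lemma IsNorm.exists_le {τ : P2 → ℝ} (h : IsNorm τ) : ∃ C : ℝ, 0 < C ∧ ∀ x : P2, τ x ≤ C * ‖x‖ := by
  refine ⟨τ (1, 0) + τ (0, 1) + 1, by have := h.nonneg (1,0); have := h.nonneg (0,1); linarith, ?_⟩
  intro x
  have e : x = x.1 • ((1 : ℝ), (0 : ℝ)) + x.2 • ((0 : ℝ), (1 : ℝ)) := by ext <;> simp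
  have h1 : |x.1| ≤ ‖x‖ := by simpa using norm_fst_le x
  have h2 : |x.2| ≤ ‖x‖ := by simpa using norm_snd_le x
  have a1 := h.nonneg (1,0)
  have a2 := h.nonneg (0,1)
  calc τ x = τ (x.1 • ((1 : ℝ), (0 : ℝ)) + x.2 • ((0 : ℝ), (1 : ℝ))) := by rw [← e]
    _ ≤ |x.1| * τ (1, 0) + |x.2| * τ (0, 1) := by
      rw [← h.smul_eq, ← h.smul_eq]; exact h.add_le _ _
    _ ≤ ‖x‖ * τ (1, 0) + ‖x‖ * τ (0, 1) := by gcongr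
    _ ≤ _ := by nlinarith [norm_nonneg x]

lemma IsNorm.continuous {τ : P2 → ℝ} (h : IsNorm τ) : Continuous τ := by
  obtain ⟨C, hC, hb⟩ := h.exists_le
  refine (LipschitzWith.of_dist_le_mul (K := ⟨C, hC.le⟩) fun x y => ?_).continuous
  rw [Real.dist_eq, dist_eq_norm, abs_le]
  have h1 := h.add_le (x - y) y
  have h2 := h.add_le (y - x) x
  have h3 := h.sub_comm x y
  have h4 := hb (x - y)
  simp at h1 h2
  change -(C * ‖x - y‖) ≤ _ ∧ _ ≤ C * ‖x - y‖
  constructor <;> linarith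

lemma IsNorm.exists_ge {τ : P2 → ℝ} (h : IsNorm τ) : ∃ c : ℝ, 0 < c ∧ ∀ x : P2, ‖x‖ ≤ c * τ x := by
  have hs : IsCompact (Metric.sphere (0 : P2) 1) := isCompact_sphere _ _
  have hne : (Metric.sphere (0 : P2) 1).Nonempty := ⟨(1, 0), by simp⟩
  obtain ⟨z, hz, hmin⟩ := hs.exists_isMinOn hne h.continuous.continuousOn
  have hz0 : z ≠ 0 := by rintro rfl; simp at hz
  have hp : 0 < τ z := lt_of_le_of_ne (h.nonneg z) fun e => hz0 ((h.eq_zero_iff z).1 e.symm)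
  refine ⟨(τ z)⁻¹, inv_pos.2 hp, fun x => ?_⟩
  rcases eq_or_ne x 0 with rfl | hx
  · simp [h.zero]
  have hxp : 0 < ‖x‖ := norm_pos_iff.2 hx
  have hm : τ z ≤ τ (‖x‖⁻¹ • x) := hmin (by simp [norm_smul, hxp.ne'])
  rw [h.smul_eq, abs_of_pos (inv_pos.2 hxp)] at hm
  rw [inv_mul_eq_div] at hm ⊢
  rw [le_div_iff₀ hp]
  rw [le_div_iff₀ hxp] at hm
  linarith

/-! ### The plane with norm `τ` -/

def TN (τ : P2 → ℝ) (_h : IsNorm τ) : Type := P2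

noncomputable section TNsec
variable {τ : P2 → ℝ} (h : IsNorm τ)

instance : AddCommGroup (TN τ h) := inferInstanceAs (AddCommGroup P2)
instance : Module ℝ (TN τ h) := inferInstanceAs (Module ℝ P2)
instance : Norm (TN τ h) := ⟨τ⟩

lemma TN.core : NormedSpace.Core ℝ (TN τ h) where
  norm_nonneg x := h.nonneg x
  norm_smul c x := h.smul_eq c x
  norm_triangle x y := h.add_le x y
  norm_eq_zero_iff x := h.eq_zero_iff x

instance : NormedAddCommGroup (TN τ h) := NormedAddCommGroup.ofCore (TN.core h)
instance : NormedSpace ℝ (TN τ h) := NormedSpace.ofCore (TN.core h)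
instance : MeasurableSpace (TN τ h) := borel _
instance : BorelSpace (TN τ h) := ⟨rfl⟩

end TNsec

lemma TN.edist_eq {τ : P2 → ℝ} (h : IsNorm τ) (a b : TN τ h) :
    edist a b = ENNReal.ofReal (τ ((show P2 from a) - (show P2 from b))) := by
  rw [edist_dist, dist_eq_norm]; rfl

lemma tauDiam_eq {τ : P2 → ℝ} (h : IsNorm τ) (A : Set P2) :
    tauDiam τ A = Metric.ediam (X := TN τ h) A := by
  unfold tauDiam Metric.ediam
  simp only [TN.edist_eq]
  rfl

open MeasureTheory MeasureTheory.Measure in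
lemma tauLen_eq {τ : P2 → ℝ} (h : IsNorm τ) (S : Set P2) :
    tauLen τ S = μH[1] (show Set (TN τ h) from S) := by
  rw [hausdorffMeasure_apply]
  have key : ∀ r : ℝ≥0∞, (⨅ (A : ℕ → Set P2) (_ : S ⊆ ⋃ i, A i)
      (_ : ∀ i, tauDiam τ (A i) ≤ r), ∑' i, tauDiam τ (A i)) =
      ⨅ (t : ℕ → Set (TN τ h)) (_ : (show Set (TN τ h) from S) ⊆ ⋃ n, t n)
        (_ : ∀ n, Metric.ediam (t n) ≤ r),
          ∑' n, ⨆ _ : (t n).Nonempty, Metric.ediam (t n) ^ (1 : ℝ) := by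
    intro r
    have : ∀ t : ℕ → Set (TN τ h), ∀ n, (⨆ _ : (t n).Nonempty, Metric.ediam (t n) ^ (1 : ℝ)) =
        Metric.ediam (t n) := by
      intro t n
      rcases (t n).eq_empty_or_nonempty with e | e
      · simp [e]
      · simp [e]
    simp only [this, tauDiam_eq h]
    rfl
  unfold tauLen
  simp only [key]
  apply le_antisymm
  · refine iSup₂_le fun ε hε => ?_
    exact le_iSup₂_of_le (ENNReal.ofReal ε) (by simpa using hε) le_rfl
  · refine iSup₂_le fun r hr => ?_
    rcases eq_or_ne r ⊤ with rfl | hr'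
    · refine le_iSup₂_of_le 1 one_pos ?_
      refine iInf_mono fun t => iInf_mono fun ht => ?_
      simp
    · refine le_iSup₂_of_le r.toReal (ENNReal.toReal_pos hr.ne' hr') ?_
      rw [ENNReal.ofReal_toReal hr']

lemma tauLen_mono {τ : P2 → ℝ} (h : IsNorm τ) {S T : Set P2} (hST : S ⊆ T) :
    tauLen τ S ≤ tauLen τ T := by
  rw [tauLen_eq h, tauLen_eq h]; exact MeasureTheory.measure_mono hST

lemma tauLen_empty {τ : P2 → ℝ} (h : IsNorm τ) : tauLen τ ∅ = 0 := by
  rw [tauLen_eq h]; exact MeasureTheory.measure_empty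

lemma tauLen_union {τ : P2 → ℝ} (h : IsNorm τ) (S T : Set P2) :
    tauLen τ (S ∪ T) ≤ tauLen τ S + tauLen τ T := by
  simp only [tauLen_eq h]; exact MeasureTheory.measure_union_le _ _

lemma tauLen_iUnion {τ : P2 → ℝ} (h : IsNorm τ) {n : ℕ} (T : Fin n → Set P2) :
    tauLen τ (⋃ i, T i) ≤ ∑ i, tauLen τ (T i) := by
  simp only [tauLen_eq h]; exact MeasureTheory.measure_iUnion_fintype_le _ _

lemma tauLen_segment {τ : P2 → ℝ} (h : IsNorm τ) (a b : P2) :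
    tauLen τ (segment ℝ a b) = ENNReal.ofReal (τ (a - b)) := by
  rw [tauLen_eq h]
  refine (MeasureTheory.hausdorffMeasure_segment (E := TN τ h) a b).trans ?_
  exact TN.edist_eq h a b

open scoped Pointwise in
lemma tauLen_smul {τ : P2 → ℝ} (h : IsNorm τ) {c : ℝ} (hc : 0 < c) (S : Set P2) :
    tauLen τ (c • S) = ENNReal.ofReal c * tauLen τ S := by
  rw [tauLen_eq h, tauLen_eq h]
  refine (MeasureTheory.Measure.hausdorffMeasure_smul₀ (E := TN τ h) zero_le_one hc.ne' S).trans ?_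
  rw [NNReal.rpow_one, ENNReal.smul_def, smul_eq_mul]
  congr 1
  rw [ENNReal.ofReal, ENNReal.coe_inj]
  ext; simp [hc.le]

lemma tauLen_dist {τ : P2 → ℝ} (h : IsNorm τ) {S : Set P2} {x y : P2}
    (hy : y ∈ connectedComponentIn S x) : ENNReal.ofReal (τ (y - x)) ≤ tauLen τ S := by
  have hx : x ∈ connectedComponentIn S x := by
    by_cases hx : x ∈ S
    · exact mem_connectedComponentIn hx
    · simp [connectedComponentIn_eq_empty hx] at hy
  let f : P2 → ℝ := fun z => τ (z - x)
  have hf : Continuous f := h.continuous.comp (continuous_id.sub continuous_const)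
  have hpre : IsPreconnected (f '' connectedComponentIn S x) :=
    isPreconnected_connectedComponentIn.image f hf.continuousOn
  have hsub : Set.Icc 0 (τ (y - x)) ⊆ f '' connectedComponentIn S x :=
    hpre.ordConnected.out ⟨x, hx, by simp [f, h.zero]⟩ ⟨y, hy, rfl⟩
  have hlip : LipschitzWith 1 (show TN τ h → ℝ from f) := by
    refine LipschitzWith.of_dist_le_mul fun a b => ?_
    have h0 : ∀ a b : P2, |τ (a - x) - τ (b - x)| ≤ τ (a - b) := by
      intro a b
      have h1 := h.tri a b x
      have h2 := h.tri b a x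
      have h3 := h.sub_comm a b
      rw [abs_le]
      constructor <;> linarith
    rw [NNReal.coe_one, one_mul]
    rw [Real.dist_eq, dist_eq_norm]; exact h0 a b
  calc ENNReal.ofReal (τ (y - x)) = MeasureTheory.volume (Set.Icc 0 (τ (y - x))) := by simp
    _ ≤ MeasureTheory.volume (f '' connectedComponentIn S x) := MeasureTheory.measure_mono hsub
    _ ≤ tauLen τ (connectedComponentIn S x) := by
      rw [← MeasureTheory.hausdorffMeasure_real, tauLen_eq h]
      generalize connectedComponentIn S x = Z
      have := hlip.hausdorffMeasure_image_le zero_le_one (show Set (TN τ h) from Z)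
      rw [ENNReal.coe_one, ENNReal.one_rpow, one_mul] at this
      exact this
    _ ≤ tauLen τ S := tauLen_mono h (connectedComponentIn_subset _ _)

/-! ### Combinatorial decomposition, and Golab's theorem -/

/-- `τ`-diameter of `A` is at most `d`. -/
def DiamLe (τ : P2 → ℝ) (A : Set P2) (d : ℝ) : Prop := ∀ x ∈ A, ∀ y ∈ A, τ (x - y) ≤ d

lemma DiamLe.union {τ : P2 → ℝ} (h : IsNorm τ) {A B : Set P2} {a b : ℝ} (ha0 : 0 ≤ a) (hb0 : 0 ≤ b)
    (hA : DiamLe τ A a) (hB : DiamLe τ B b) (hne : (A ∩ B).Nonempty) : DiamLe τ (A ∪ B) (a + b) := by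
  obtain ⟨z, hzA, hzB⟩ := hne
  rintro x (hx | hx) y (hy | hy)
  · linarith [hA x hx y hy]
  · linarith [hA x hx z hzA, hB z hzB y hy, h.tri x z y]
  · linarith [hB x hx z hzB, hA z hzA y hy, h.tri x z y]
  · linarith [hB x hx y hy]

lemma sum_update_range (n m : ℕ) (hm : m < n) (ρ : ℕ → ℝ) (b : ℝ) :
    ∑ i ∈ Finset.range n, Function.update ρ m b i = ∑ i ∈ Finset.range n, ρ i - ρ m + b := by
  have hm' : m ∈ Finset.range n := Finset.mem_range.2 hm
  rw [Finset.sum_update_of_mem hm', Finset.sum_eq_add_sum_sdiff_singleton_of_mem hm' ρ]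
  ring

lemma decomp {τ : P2 → ℝ} (h : IsNorm τ) (U : ℕ → Set P2) (w : ℕ → ℝ) (ε δ : ℝ)
    (hε : 0 ≤ ε) (hεδ : ε ≤ δ) (p : ℕ → ℕ) :
    ∀ (n : ℕ) (rt : Finset ℕ) (R : ℕ → Set P2) (ρ : ℕ → ℝ),
      (∀ i < n, DiamLe τ (U i) (w i) ∧ 0 ≤ w i ∧ w i ≤ ε) →
      (∀ i < n, U i ⊆ R i ∧ DiamLe τ (R i) (ρ i) ∧ 0 ≤ ρ i ∧ ρ i ≤ δ) →
      (∀ i < n, i ∈ rt ∨ (p i < i ∧ (U i ∩ U (p i)).Nonempty)) →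
      ∃ l : List (Set P2 × ℝ), (∀ i < n, ∀ x ∈ R i, ∃ a ∈ l, x ∈ a.1) ∧
        (∀ a ∈ l, DiamLe τ a.1 a.2 ∧ 0 ≤ a.2 ∧ a.2 ≤ 2 * δ) ∧
        (l.length : ℝ) * (δ - ε) ≤ rt.card * (δ - ε) + ∑ i ∈ Finset.range n, ρ i ∧
        (l.map Prod.snd).sum ≤ ∑ i ∈ Finset.range n, ρ i + ε * l.length := by
  intro n
  induction n with
  | zero =>
    intro rt R ρ _ _ _
    refine ⟨[], by simp, by simp, ?_, by simp⟩
    have : 0 ≤ δ - ε := by linarith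
    simp only [List.length_nil, Nat.cast_zero, zero_mul, Finset.range_zero, Finset.sum_empty,
      add_zero]
    positivity
  | succ n ih =>
    intro rt R ρ hU hR hp
    have hUn : ∀ i < n, DiamLe τ (U i) (w i) ∧ 0 ≤ w i ∧ w i ≤ ε := fun i hi => hU i (by omega)
    have hRn : ∀ i < n, U i ⊆ R i ∧ DiamLe τ (R i) (ρ i) ∧ 0 ≤ ρ i ∧ ρ i ≤ δ :=
      fun i hi => hR i (by omega)
    obtain ⟨hn1, hn2, hn3, hn4⟩ := hR n (by omega)
    by_cases hrt : n ∈ rt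
    · obtain ⟨l, hl1, hl2, hl3, hl4⟩ := ih (rt.erase n) R ρ hUn hRn (by
        intro i hi
        rcases hp i (by omega) with h1 | h1
        · exact Or.inl (Finset.mem_erase.2 ⟨by omega, h1⟩)
        · exact Or.inr h1)
      refine ⟨(R n, ρ n) :: l, ?_, ?_, ?_, ?_⟩
      · intro i hi x hx
        rcases Nat.lt_succ_iff_lt_or_eq.1 hi with h1 | rfl
        · obtain ⟨a, ha, hxa⟩ := hl1 i h1 x hx
          exact ⟨a, by simp [ha], hxa⟩
        · exact ⟨_, List.mem_cons_self, hx⟩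
      · intro a ha
        rcases List.mem_cons.1 ha with rfl | ha
        · exact ⟨hn2, hn3, by simp only; linarith⟩
        · exact hl2 a ha
      · have hc : (rt.card : ℝ) = (rt.erase n).card + 1 := by
          rw [← Finset.card_erase_add_one hrt]; push_cast; rfl
        rw [hc, Finset.sum_range_succ, List.length_cons]
        push_cast
        linarith
      · rw [Finset.sum_range_succ, List.map_cons, List.sum_cons, List.length_cons]
        push_cast
        linarith
    · have hpn : p n < n ∧ (U n ∩ U (p n)).Nonempty := (hp n (by omega)).resolve_left hrt
      obtain ⟨hm, hne⟩ := hpn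
      set m := p n with hmdef
      obtain ⟨hm1, hm2, hm3, hm4⟩ := hRn m hm
      have hpn' : ∀ i < n, i ∈ rt ∨ (p i < i ∧ (U i ∩ U (p i)).Nonempty) :=
        fun i hi => hp i (by omega)
      have hd : DiamLe τ (R m ∪ R n) (ρ m + ρ n) := by
        refine DiamLe.union h hm3 hn3 hm2 hn2 ?_
        obtain ⟨z, hz1, hz2⟩ := hne
        exact ⟨z, hm1 hz2, hn1 hz1⟩
      by_cases hs : ρ m + ρ n ≤ δ
      · obtain ⟨l, hl1, hl2, hl3, hl4⟩ := ih rt (Function.update R m (R m ∪ R n))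
          (Function.update ρ m (ρ m + ρ n)) hUn (by
            intro i hi
            rcases eq_or_ne i m with rfl | him
            · simp only [Function.update_self]
              exact ⟨hm1.trans Set.subset_union_left, hd, by linarith, hs⟩
            · simp only [Function.update_of_ne him]
              exact hRn i hi) hpn'
        rw [sum_update_range n m hm] at hl3 hl4
        refine ⟨l, ?_, hl2, ?_, ?_⟩
        · intro i hi x hx
          rcases Nat.lt_succ_iff_lt_or_eq.1 hi with h1 | rfl
          · refine hl1 i h1 x ?_
            rcases eq_or_ne i m with rfl | him
            · simp only [Function.update_self]; exact Or.inl hx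
            · simpa only [Function.update_of_ne him] using hx
          · refine hl1 m hm x ?_
            simp only [Function.update_self]; exact Or.inr hx
        · rw [Finset.sum_range_succ]; linarith
        · rw [Finset.sum_range_succ]; linarith
      · obtain ⟨hw1, hw2, hw3⟩ := hUn m hm
        obtain ⟨l, hl1, hl2, hl3, hl4⟩ := ih rt (Function.update R m (U m))
          (Function.update ρ m (w m)) hUn (by
            intro i hi
            rcases eq_or_ne i m with rfl | him
            · simp only [Function.update_self]
              exact ⟨subset_rfl, hw1, hw2, hw3.trans hεδ⟩
            · simp only [Function.update_of_ne him]
              exact hRn i hi) hpn'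
        rw [sum_update_range n m hm] at hl3 hl4
        refine ⟨(R m ∪ R n, ρ m + ρ n) :: l, ?_, ?_, ?_, ?_⟩
        · intro i hi x hx
          rcases Nat.lt_succ_iff_lt_or_eq.1 hi with h1 | rfl
          · rcases eq_or_ne i m with rfl | him
            · exact ⟨_, List.mem_cons_self, Or.inl hx⟩
            · obtain ⟨a, ha, hxa⟩ := hl1 i h1 x (by simpa only [Function.update_of_ne him] using hx)
              exact ⟨a, by simp [ha], hxa⟩
          · exact ⟨_, List.mem_cons_self, Or.inr hx⟩
        · intro a ha
          rcases List.mem_cons.1 ha with rfl | ha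
          · exact ⟨hd, by simp only; linarith, by simp only; linarith⟩
          · exact hl2 a ha
        · rw [Finset.sum_range_succ, List.length_cons]
          push_cast
          linarith
        · rw [Finset.sum_range_succ, List.map_cons, List.sum_cons, List.length_cons]
          push_cast
          linarith

open Classical in
lemma ordering {I : Type} [Fintype I] [Nonempty I] (U : I → Set P2) (S : Set P2) (E : Finset P2)
    (hopen : ∀ i, IsOpen (U i)) (hcov : S ⊆ ⋃ i, U i) (hmeet : ∀ i, (U i ∩ S).Nonempty)
    (hE : ∀ x ∈ S, (connectedComponentIn S x ∩ (E : Set P2)).Nonempty) :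
    ∀ k ≤ Fintype.card I, ∃ (f : ℕ → I) (p : ℕ → ℕ) (rt : Finset ℕ),
      Set.InjOn f (Set.Iio k) ∧
      (∀ i < k, i ∈ rt ∨ (p i < i ∧ (U (f i) ∩ U (f (p i))).Nonempty)) ∧
      rt.card ≤ (E.filter (fun e => ∃ i < k, e ∈ U (f i))).card := by
  intro k
  induction k with
  | zero =>
    intro _
    exact ⟨fun _ => Classical.arbitrary I, id, ∅, by simp [Set.InjOn], by simp, by simp⟩
  | succ k ih =>
    intro hk
    obtain ⟨f, p, rt, hinj, hpar, hcard⟩ := ih (by omega)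
    have hupd : ∀ (i' : I), i' ∉ f '' Set.Iio k →
        Set.InjOn (Function.update f k i') (Set.Iio (k + 1)) := by
      intro i' hi' a ha b hb hab
      simp only [Set.mem_Iio] at ha hb
      rcases eq_or_ne a k with rfl | hak <;> rcases eq_or_ne b a with rfl | hba
      · rfl
      · simp only [Function.update_self, Function.update_of_ne hba] at hab
        exact absurd ⟨b, by simp; omega, hab.symm⟩ hi'
      · rfl
      · rcases eq_or_ne b k with rfl | hbk
        · simp only [Function.update_self, Function.update_of_ne hak] at hab
          exact absurd ⟨a, by simp; omega, hab⟩ hi'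
        · simp only [Function.update_of_ne hbk, Function.update_of_ne hak] at hab
          exact hinj (by simp; omega) (by simp; omega) hab
    have hlt : ∀ (i' : I), ∀ i < k, Function.update f k i' i = f i := fun i' i hi =>
      Function.update_of_ne (by omega) _ _
    by_cases hch : ∃ i', i' ∉ f '' Set.Iio k ∧ ∃ j < k, (U i' ∩ U (f j)).Nonempty
    · obtain ⟨i', hi', j, hj, hne⟩ := hch
      refine ⟨Function.update f k i', Function.update p k j, rt, hupd i' hi', ?_, ?_⟩
      · intro i hi
        rcases Nat.lt_succ_iff_lt_or_eq.1 hi with h1 | rfl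
        · rcases hpar i h1 with h2 | ⟨h2, h3⟩
          · exact Or.inl h2
          · right
            rw [Function.update_of_ne (by omega : i ≠ k), hlt i' i h1, hlt i' _ (h2.trans h1)]
            exact ⟨h2, h3⟩
        · right
          rw [Function.update_self, Function.update_self, hlt i' j hj]
          exact ⟨hj, hne⟩
      · refine hcard.trans (Finset.card_le_card ?_)
        intro e he
        simp only [Finset.mem_filter] at he ⊢
        obtain ⟨heE, i, hi, hei⟩ := he
        exact ⟨heE, i, by omega, by rwa [hlt i' i hi]⟩
    · have hex : ∃ i', i' ∉ f '' Set.Iio k := by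
        by_contra hcon
        push Not at hcon
        have h1 : Fintype.card I ≤ k := by
          have : (Finset.univ : Finset I) ⊆ (Finset.range k).image f := by
            intro i _
            obtain ⟨j, hj, hji⟩ := hcon i
            exact Finset.mem_image.2 ⟨j, by simpa using hj, hji⟩
          have := Finset.card_le_card this
          have h2 := Finset.card_image_le (s := Finset.range k) (f := f)
          simp at this h2
          omega
        omega
      obtain ⟨i₀, hi₀⟩ := hex
      let V : Set P2 := ⋃ j ∈ Set.Iio k, U (f j)
      let W : Set P2 := ⋃ i ∈ (f '' Set.Iio k)ᶜ, U i
      have hV : IsOpen V := isOpen_biUnion fun _ _ => hopen _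
      have hW : IsOpen W := isOpen_biUnion fun _ _ => hopen _
      have hVW : Disjoint V W := by
        rw [Set.disjoint_left]
        intro x hxV hxW
        simp only [V, W, Set.mem_iUnion] at hxV hxW
        obtain ⟨j, hj, hxj⟩ := hxV
        obtain ⟨i, hi, hxi⟩ := hxW
        exact hch ⟨i, hi, j, hj, x, hxi, hxj⟩
      obtain ⟨x, hxU, hxS⟩ := hmeet i₀
      have hCsub : connectedComponentIn S x ⊆ V ∪ W := by
        intro y hy
        obtain ⟨i, hi⟩ := Set.mem_iUnion.1 (hcov (connectedComponentIn_subset _ _ hy))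
        by_cases hij : i ∈ f '' Set.Iio k
        · obtain ⟨j, hj, rfl⟩ := hij
          exact Or.inl (Set.mem_biUnion hj hi)
        · exact Or.inr (Set.mem_biUnion (show i ∈ (f '' Set.Iio k)ᶜ from hij) hi)
      have hCW : connectedComponentIn S x ⊆ W :=
        IsPreconnected.subset_right_of_subset_union hV hW hVW hCsub
          ⟨x, mem_connectedComponentIn hxS,
            Set.mem_biUnion (show i₀ ∈ (f '' Set.Iio k)ᶜ from hi₀) hxU⟩
          isPreconnected_connectedComponentIn
      obtain ⟨e, heC, heE⟩ := hE x hxS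
      have heW := hCW heC
      have heV : e ∉ V := fun hv => Set.disjoint_left.1 hVW hv heW
      simp only [W, Set.mem_iUnion] at heW
      obtain ⟨i', hi', hei'⟩ := heW
      refine ⟨Function.update f k i', p, insert k rt, hupd i' hi', ?_, ?_⟩
      · intro i hi
        rcases Nat.lt_succ_iff_lt_or_eq.1 hi with h1 | rfl
        · rcases hpar i h1 with h2 | ⟨h2, h3⟩
          · exact Or.inl (Finset.mem_insert_of_mem h2)
          · right
            rw [hlt i' i h1, hlt i' _ (h2.trans h1)]
            exact ⟨h2, h3⟩
        · exact Or.inl (Finset.mem_insert_self _ _)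
      · refine (Finset.card_insert_le _ _).trans ?_
        have hnot : e ∉ E.filter (fun e => ∃ i < k, e ∈ U (f i)) := by
          simp only [Finset.mem_filter, not_and]
          rintro _ ⟨i, hi, hei⟩
          exact heV (Set.mem_biUnion (show i ∈ Set.Iio k from hi) hei)
        have hsub : insert e (E.filter (fun e => ∃ i < k, e ∈ U (f i))) ⊆
            E.filter (fun e => ∃ i < k + 1, e ∈ U (Function.update f k i' i)) := by
          intro e' he'
          rcases Finset.mem_insert.1 he' with rfl | he'
          · simp only [Finset.mem_filter]
            exact ⟨heE, k, by omega, by rwa [Function.update_self]⟩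
          · simp only [Finset.mem_filter] at he' ⊢
            obtain ⟨heE, i, hi, hei⟩ := he'
            exact ⟨heE, i, by omega, by rwa [hlt i' i hi]⟩
        have := Finset.card_le_card hsub
        rw [Finset.card_insert_of_notMem hnot] at this
        omega

lemma tauDiam_le_iff {τ : P2 → ℝ} {A : Set P2} {d : ℝ} (hd : 0 ≤ d) :
    tauDiam τ A ≤ ENNReal.ofReal d ↔ DiamLe τ A d := by
  unfold tauDiam DiamLe
  simp only [iSup_le_iff, ENNReal.ofReal_le_ofReal_iff hd]

/-- Open `τ`-neighbourhood. -/
def thick (τ : P2 → ℝ) (η : ℝ) (A : Set P2) : Set P2 := {x | ∃ a ∈ A, τ (x - a) < η}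

lemma thick_isOpen {τ : P2 → ℝ} (h : IsNorm τ) (η : ℝ) (A : Set P2) : IsOpen (thick τ η A) := by
  have : thick τ η A = ⋃ a ∈ A, {x | τ (x - a) < η} := by
    ext x; simp [thick]
  rw [this]
  exact isOpen_biUnion fun a _ =>
    isOpen_lt (h.continuous.comp (continuous_id.sub continuous_const)) continuous_const

lemma thick_diam {τ : P2 → ℝ} (h : IsNorm τ) {η d : ℝ} {A : Set P2} (hA : DiamLe τ A d) :
    DiamLe τ (thick τ η A) (d + 2 * η) := by
  rintro x ⟨a, ha, hxa⟩ y ⟨b, hb, hyb⟩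
  have h1 := h.tri x a y
  have h2 := h.tri a b y
  have h3 := hA a ha b hb
  have h4 := h.sub_comm b y
  linarith

lemma open_cover {τ : P2 → ℝ} (h : IsNorm τ) {S : Set P2} (hS : IsCompact S) {L ε : ℝ}
    (hL : tauLen τ S < ENNReal.ofReal L) (hε : 0 < ε) :
    ∃ (t : Finset ℕ) (U : ℕ → Set P2) (w : ℕ → ℝ), (∀ i, IsOpen (U i)) ∧ S ⊆ ⋃ i ∈ t, U i ∧
      (∀ i ∈ t, (U i ∩ S).Nonempty) ∧
      (∀ i, DiamLe τ (U i) (w i) ∧ 0 ≤ w i ∧ w i ≤ ε) ∧ ∑ i ∈ t, w i ≤ L := by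
  classical
  have hL0 : 0 < L := by
    by_contra hcon
    rw [ENNReal.ofReal_of_nonpos (by linarith)] at hL
    exact not_lt_bot hL
  have h1 : (⨅ (A : ℕ → Set P2) (_ : S ⊆ ⋃ i, A i)
      (_ : ∀ i, tauDiam τ (A i) ≤ ENNReal.ofReal (ε / 2)),
      ∑' i, tauDiam τ (A i)) < ENNReal.ofReal L :=
    lt_of_le_of_lt (le_iSup₂_of_le (f := fun (ε : ℝ) (_ : 0 < ε) =>
      ⨅ (A : ℕ → Set P2) (_ : S ⊆ ⋃ i, A i)
      (_ : ∀ i, tauDiam τ (A i) ≤ ENNReal.ofReal ε), ∑' i, tauDiam τ (A i))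
      (ε / 2) (half_pos hε) le_rfl) hL
  simp only [iInf_lt_iff] at h1
  obtain ⟨A, hA1, hA2, hA3⟩ := h1
  have hgap : min (ENNReal.ofReal L - ∑' i, tauDiam τ (A i)) (ENNReal.ofReal (ε / 2)) ≠ 0 := by
    apply ne_of_gt
    rw [lt_min_iff]
    exact ⟨tsub_pos_of_lt hA3, by simpa using hε⟩
  obtain ⟨η, hη0, hη⟩ := ENNReal.exists_pos_sum_of_countable hgap ℕ
  have hη1 : ∀ i, (η i : ℝ) ≤ ε / 2 := by
    intro i
    have h2 : (η i : ℝ≥0∞) ≤ ENNReal.ofReal (ε / 2) :=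
      (ENNReal.le_tsum i).trans (hη.le.trans (min_le_right _ _))
    rw [← ENNReal.ofReal_coe_nnreal] at h2
    exact (ENNReal.ofReal_le_ofReal_iff (by linarith)).1 h2
  have hfin : ∀ i, tauDiam τ (A i) ≠ ⊤ := fun i => ne_top_of_le_ne_top ENNReal.ofReal_ne_top (hA2 i)
  let d : ℕ → ℝ := fun i => (tauDiam τ (A i)).toReal
  have hd : ∀ i, ENNReal.ofReal (d i) = tauDiam τ (A i) := fun i => ENNReal.ofReal_toReal (hfin i)
  have hd0 : ∀ i, 0 ≤ d i := fun i => ENNReal.toReal_nonneg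
  have hdA : ∀ i, DiamLe τ (A i) (d i) := fun i => (tauDiam_le_iff (hd0 i)).1 (hd i).ge
  have hdε : ∀ i, d i ≤ ε / 2 := fun i => by
    have := hA2 i
    rw [← hd i] at this
    exact (ENNReal.ofReal_le_ofReal_iff (by linarith)).1 this
  let U : ℕ → Set P2 := fun i => thick τ (η i / 2) (A i)
  have hcov : S ⊆ ⋃ i, U i := by
    intro x hx
    obtain ⟨i, hi⟩ := Set.mem_iUnion.1 (hA1 hx)
    refine Set.mem_iUnion.2 ⟨i, x, hi, ?_⟩
    have : (0 : ℝ) < η i := hη0 i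
    simp [h.zero]; exact hη0 i
  obtain ⟨t, ht⟩ := hS.elim_finite_subcover U (fun i => thick_isOpen h _ _) hcov
  refine ⟨t.filter (fun i => (U i ∩ S).Nonempty), U, fun i => d i + η i,
    fun i => thick_isOpen h _ _, ?_, ?_, ?_, ?_⟩
  · intro x hx
    obtain ⟨i, hi, hxi⟩ := Set.mem_iUnion₂.1 (ht hx)
    exact Set.mem_iUnion₂.2 ⟨i, Finset.mem_filter.2 ⟨hi, x, hxi, hx⟩, hxi⟩
  · intro i hi
    exact (Finset.mem_filter.1 hi).2
  · intro i
    have h0 : (0 : ℝ) < η i := hη0 i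
    refine ⟨?_, by have := hd0 i; positivity, by linarith [hη1 i, hdε i]⟩
    have := thick_diam h (η := η i / 2) (hdA i)
    convert this using 1
    ring
  · have hsum : ENNReal.ofReal (∑ i ∈ t.filter (fun i => (U i ∩ S).Nonempty), (d i + η i)) ≤
        ENNReal.ofReal L := by
      rw [ENNReal.ofReal_sum_of_nonneg (fun i _ => by have := hd0 i; positivity)]
      calc _ = ∑ i ∈ t.filter (fun i => (U i ∩ S).Nonempty), (tauDiam τ (A i) + η i) := by
            refine Finset.sum_congr rfl fun i _ => ?_
            rw [ENNReal.ofReal_add (hd0 i) (by positivity), hd i, ENNReal.ofReal_coe_nnreal]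
        _ ≤ ∑' i, (tauDiam τ (A i) + η i) := ENNReal.sum_le_tsum _
        _ = ∑' i, tauDiam τ (A i) + ∑' i, (η i : ℝ≥0∞) := ENNReal.tsum_add
        _ ≤ ∑' i, tauDiam τ (A i) + (ENNReal.ofReal L - ∑' i, tauDiam τ (A i)) := by
            gcongr; exact hη.le.trans (min_le_left _ _)
        _ = ENNReal.ofReal L := add_tsub_cancel_of_le hA3.le
    exact (ENNReal.ofReal_le_ofReal_iff hL0.le).1 hsum

lemma good_cover {τ : P2 → ℝ} (h : IsNorm τ) {S : Set P2} (hS : IsCompact S) {L ε δ : ℝ} {M : ℕ}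
    {E : Finset P2} (hEM : E.card ≤ M)
    (hE : ∀ x ∈ S, (connectedComponentIn S x ∩ (E : Set P2)).Nonempty)
    (hL : tauLen τ S < ENNReal.ofReal L) (hε : 0 < ε) (hεδ : ε ≤ δ) :
    ∃ l : List (Set P2 × ℝ), (∀ x ∈ S, ∃ a ∈ l, x ∈ a.1) ∧
        (∀ a ∈ l, DiamLe τ a.1 a.2 ∧ 0 ≤ a.2 ∧ a.2 ≤ 2 * δ) ∧
        (l.length : ℝ) * (δ - ε) ≤ M * (δ - ε) + L ∧
        (l.map Prod.snd).sum ≤ L + ε * l.length := by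
  classical
  have hL0 : 0 < L := by
    by_contra hcon
    rw [ENNReal.ofReal_of_nonpos (by linarith)] at hL
    exact not_lt_bot hL
  have hδε : 0 ≤ δ - ε := by linarith
  obtain ⟨t, U, w, hU1, hU2, hU3, hU4, hU5⟩ := open_cover h hS hL hε
  rcases t.eq_empty_or_nonempty with rfl | hne
  · refine ⟨[], ?_, by simp, ?_, ?_⟩
    · intro x hx; simpa using hU2 hx
    · simp; positivity
    · simp; positivity
  have : Nonempty t := hne.to_subtype
  obtain ⟨f, p, rt, hinj, hpar, hcard⟩ := ordering (I := t) (fun i => U i) S E (fun i => hU1 i)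
    (by
      intro x hx
      obtain ⟨i, hi, hxi⟩ := Set.mem_iUnion₂.1 (hU2 hx)
      exact Set.mem_iUnion.2 ⟨⟨i, hi⟩, hxi⟩) (fun i => hU3 i i.2) hE (Fintype.card t) le_rfl
  set n := Fintype.card t with hn
  have himg : (Finset.range n).image f = Finset.univ := by
    apply Finset.eq_univ_of_card
    rw [Finset.card_image_of_injOn (by simpa using hinj), Finset.card_range]
  have hsum : ∑ i ∈ Finset.range n, w (f i) ≤ L := by
    refine le_of_eq_of_le ?_ hU5
    rw [← Finset.sum_coe_sort t w, ← himg, Finset.sum_image (by simpa using hinj)]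
  have hrt : rt.card ≤ M := (hcard.trans (Finset.card_filter_le _ _)).trans hEM
  obtain ⟨l, hl1, hl2, hl3, hl4⟩ := decomp h (fun i => U (f i)) (fun i => w (f i)) ε δ hε.le hεδ p n
    rt (fun i => U (f i)) (fun i => w (f i)) (fun i _ => hU4 _)
    (fun i _ => ⟨subset_rfl, (hU4 _).1, (hU4 _).2.1, (hU4 _).2.2.trans hεδ⟩) hpar
  refine ⟨l, ?_, hl2, ?_, by linarith⟩
  · intro x hx
    obtain ⟨i, hi, hxi⟩ := Set.mem_iUnion₂.1 (hU2 hx)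
    have : (⟨i, hi⟩ : t) ∈ (Finset.range n).image f := by rw [himg]; simp
    obtain ⟨j, hj, hji⟩ := Finset.mem_image.1 this
    refine hl1 j (by simpa using hj) x ?_
    rw [hji]; exact hxi
  · have : (rt.card : ℝ) * (δ - ε) ≤ M * (δ - ε) := by gcongr
    linarith

lemma golab {τ : P2 → ℝ} (h : IsNorm τ) {S : Set P2} {L : ℝ} (M : ℕ)
    (hyp : ∀ η > 0, ∃ (S' : Set P2) (E : Finset P2), IsCompact S' ∧ E.card ≤ M ∧
      (∀ x ∈ S', (connectedComponentIn S' x ∩ (E : Set P2)).Nonempty) ∧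
      tauLen τ S' < ENNReal.ofReal L ∧ S ⊆ thick τ η S') :
    tauLen τ S ≤ ENNReal.ofReal L := by
  have hL0 : 0 < L := by
    obtain ⟨S', E, -, -, -, hL, -⟩ := hyp 1 one_pos
    by_contra hcon
    rw [ENNReal.ofReal_of_nonpos (by linarith)] at hL
    exact not_lt_bot hL
  refine iSup₂_le fun r hr => ?_
  set δ := r / 4 with hδ
  have hδ0 : 0 < δ := by positivity
  set N : ℝ := M + 2 * L / δ with hN
  have hN0 : 0 ≤ N := by positivity
  have key : ∀ η : ℝ, 0 < η → η ≤ δ / 2 → (⨅ (A : ℕ → Set P2) (_ : S ⊆ ⋃ i, A i)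
      (_ : ∀ i, tauDiam τ (A i) ≤ ENNReal.ofReal r), ∑' i, tauDiam τ (A i)) ≤
      ENNReal.ofReal (L + 3 * N * η) := by
    intro η hη0 hηδ
    obtain ⟨S', E, hS'c, hEM, hES, hL, hcov⟩ := hyp η hη0
    obtain ⟨l, hl1, hl2, hl3, hl4⟩ := good_cover h hS'c hEM hES hL hη0 (by linarith : η ≤ δ)
    have hlen : (l.length : ℝ) ≤ N := by
      have h1 : 0 < δ - η := by linarith
      have h2 : (l.length : ℝ) ≤ M + L / (δ - η) := by
        rw [← sub_nonneg]
        have : (M + L / (δ - η) - l.length) * (δ - η) ≥ 0 := by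
          field_simp; linarith
        exact nonneg_of_mul_nonneg_left this h1
      have h3 : L / (δ - η) ≤ 2 * L / δ := by
        rw [div_le_div_iff₀ h1 hδ0]; nlinarith
      linarith
    let A : ℕ → Set P2 := fun i => if hi : i < l.length then thick τ η (l[i].1) else ∅
    let v : ℕ → ℝ := fun i => if hi : i < l.length then l[i].2 + 2 * η else 0
    have hv0 : ∀ i, 0 ≤ v i := by
      intro i
      by_cases hi : i < l.length
      · have := (hl2 l[i] (List.getElem_mem hi)).2.1
        simp only [v, hi, dif_pos]; positivity
      · simp only [v, hi, dif_neg, not_false_eq_true]; exact le_rfl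
    have hAv : ∀ i, tauDiam τ (A i) ≤ ENNReal.ofReal (v i) := by
      intro i
      rw [tauDiam_le_iff (hv0 i)]
      by_cases hi : i < l.length
      · simp only [v, A, hi, dif_pos]
        exact thick_diam h (hl2 l[i] (List.getElem_mem hi)).1
      · simp only [v, A, hi, dif_neg, not_false_eq_true]
        intro x hx; exact hx.elim
    refine iInf₂_le_of_le A ?_ (iInf_le_of_le ?_ ?_)
    · intro x hx
      obtain ⟨y, hy, hxy⟩ := hcov hx
      obtain ⟨a, ha, hya⟩ := hl1 y hy
      obtain ⟨i, hi, hia⟩ := List.mem_iff_getElem.1 ha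
      refine Set.mem_iUnion.2 ⟨i, ?_⟩
      simp only [A, hi, dif_pos]
      exact ⟨y, by rw [hia]; exact hya, hxy⟩
    · intro i
      refine (hAv i).trans (ENNReal.ofReal_le_ofReal ?_)
      by_cases hi : i < l.length
      · have := (hl2 l[i] (List.getElem_mem hi)).2.2
        simp only [v, hi, dif_pos]; linarith
      · simp only [v, hi, dif_neg, not_false_eq_true]; exact hr.le
    · calc ∑' i, tauDiam τ (A i) ≤ ∑' i, ENNReal.ofReal (v i) := ENNReal.tsum_le_tsum hAv
        _ = ∑ i ∈ Finset.range l.length, ENNReal.ofReal (v i) := by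
          refine tsum_eq_sum fun i hi => ?_
          have : ¬ i < l.length := by simpa using hi
          simp only [v, this, dif_neg, not_false_eq_true, ENNReal.ofReal_zero]
        _ = ENNReal.ofReal (∑ i ∈ Finset.range l.length, v i) :=
          (ENNReal.ofReal_sum_of_nonneg fun i _ => hv0 i).symm
        _ ≤ _ := by
          apply ENNReal.ofReal_le_ofReal
          have h1 : ∑ i ∈ Finset.range l.length, v i =
              (l.map Prod.snd).sum + 2 * η * l.length := by
            rw [Finset.sum_range]
            have : ∀ i : Fin l.length, v i = l[i].2 + 2 * η := by
              intro i; simp only [v, i.2, dif_pos]; rfl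
            simp only [this, Finset.sum_add_distrib]
            congr 1
            · rw [← List.sum_ofFn]; congr 1
              apply List.ext_getElem <;> simp
            · simp; ring
          rw [h1]
          nlinarith
  refine ENNReal.le_of_forall_pos_le_add fun ε hε _ => ?_
  have hε' : (0 : ℝ) < ε := hε
  refine (key (min (δ / 2) (ε / (3 * N + 1))) (by positivity) (min_le_left _ _)).trans ?_
  rw [← ENNReal.ofReal_coe_nnreal, ← ENNReal.ofReal_add hL0.le hε'.le]
  apply ENNReal.ofReal_le_ofReal
  have h1 : min (δ / 2) (ε / (3 * N + 1)) ≤ ε / (3 * N + 1) := min_le_right _ _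
  have h2 : 3 * N * min (δ / 2) (ε / (3 * N + 1)) ≤ 3 * N * (ε / (3 * N + 1)) := by gcongr
  have h3 : 3 * N * (ε / (3 * N + 1)) ≤ ε := by
    rw [← mul_div_assoc, div_le_iff₀ (by positivity)]; nlinarith
  linarith

/-! ### Limits along an ultrafilter -/

section Limits
open Filter Topology

/-- The limit of a sequence of sets along an ultrafilter. -/
def limSet (𝒰 : Ultrafilter ℕ) (S : ℕ → Set P2) : Set P2 :=
  {x | ∀ ε > 0, ∀ᶠ n in (𝒰 : Filter ℕ), ∃ y ∈ S n, dist x y < ε}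

lemma ultra_lim (𝒰 : Ultrafilter ℕ) {K : Set P2} (hK : IsCompact K) {y : ℕ → P2}
    (hy : ∀ᶠ n in (𝒰 : Filter ℕ), y n ∈ K) : ∃ z ∈ K, Tendsto y 𝒰 (𝓝 z) := by
  obtain ⟨z, hz, hle⟩ := hK.ultrafilter_le_nhds (𝒰.map y) (le_principal_iff.2 hy)
  exact ⟨z, hz, hle⟩

lemma mem_limSet {𝒰 : Ultrafilter ℕ} {S : ℕ → Set P2} {y : ℕ → P2} {z : P2}
    (hy : ∀ᶠ n in (𝒰 : Filter ℕ), y n ∈ S n) (hz : Tendsto y 𝒰 (𝓝 z)) : z ∈ limSet 𝒰 S := by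
  intro ε hε
  filter_upwards [hy, Metric.tendsto_nhds.1 hz ε hε] with n h1 h2
  exact ⟨y n, h1, by rwa [dist_comm]⟩

lemma limSet_compact {𝒰 : Ultrafilter ℕ} {S : ℕ → Set P2} {R : ℝ}
    (hS : ∀ n, S n ⊆ Metric.closedBall 0 R) : IsCompact (limSet 𝒰 S) := by
  have hcl : IsClosed (limSet 𝒰 S) := by
    rw [← closure_subset_iff_isClosed]
    intro x hx ε hε
    obtain ⟨x', hx', hd⟩ := Metric.mem_closure_iff.1 hx (ε / 2) (half_pos hε)
    filter_upwards [hx' (ε / 2) (half_pos hε)] with n hn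
    obtain ⟨y, hy, hdy⟩ := hn
    exact ⟨y, hy, by linarith [dist_triangle x x' y]⟩
  refine (isCompact_closedBall (0 : P2) (R + 1)).of_isClosed_subset hcl ?_
  intro x hx
  obtain ⟨n, y, hy, hd⟩ := (hx 1 one_pos).exists
  have := hS n hy
  rw [Metric.mem_closedBall] at this ⊢
  linarith [dist_triangle x y 0]

lemma limSet_open {𝒰 : Ultrafilter ℕ} {S : ℕ → Set P2} {R : ℝ}
    (hS : ∀ n, S n ⊆ Metric.closedBall 0 R) {O : Set P2} (hO : IsOpen O) (hsub : limSet 𝒰 S ⊆ O) :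
    ∀ᶠ n in (𝒰 : Filter ℕ), S n ⊆ O := by
  by_contra hcon
  rw [← Ultrafilter.eventually_not] at hcon
  have h1 : ∀ n, ∃ y, ¬ (S n ⊆ O) → y ∈ S n ∧ y ∉ O := by
    intro n
    by_cases hn : S n ⊆ O
    · exact ⟨0, fun h => absurd hn h⟩
    · obtain ⟨y, hy1, hy2⟩ := Set.not_subset.1 hn
      exact ⟨y, fun _ => ⟨hy1, hy2⟩⟩
  choose y hy using h1
  obtain ⟨z, -, hz⟩ := ultra_lim 𝒰 (isCompact_closedBall (0 : P2) R) (y := y)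
    (hcon.mono fun n hn => hS n (hy n hn).1)
  have hzO : z ∈ O := hsub (mem_limSet (hcon.mono fun n hn => (hy n hn).1) hz)
  obtain ⟨n, hn1, hn2⟩ := ((hz.eventually (hO.mem_nhds hzO)).and hcon).exists
  exact (hy n hn2).2 hn1

lemma limSet_thick {τ : P2 → ℝ} (h : IsNorm τ) {𝒰 : Ultrafilter ℕ} {S : ℕ → Set P2} {R : ℝ}
    (hS : ∀ n, S n ⊆ Metric.closedBall 0 R) {η : ℝ} (hη : 0 < η) :
    ∀ᶠ n in (𝒰 : Filter ℕ), limSet 𝒰 S ⊆ thick τ η (S n) := by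
  by_contra hcon
  rw [← Ultrafilter.eventually_not] at hcon
  have h1 : ∀ n, ∃ y, ¬ (limSet 𝒰 S ⊆ thick τ η (S n)) → y ∈ limSet 𝒰 S ∧ y ∉ thick τ η (S n) := by
    intro n
    by_cases hn : limSet 𝒰 S ⊆ thick τ η (S n)
    · exact ⟨0, fun h => absurd hn h⟩
    · obtain ⟨y, hy1, hy2⟩ := Set.not_subset.1 hn
      exact ⟨y, fun _ => ⟨hy1, hy2⟩⟩
  choose y hy using h1
  obtain ⟨z, hz, hlim⟩ := ultra_lim 𝒰 (limSet_compact hS) (y := y)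
    (hcon.mono fun n hn => (hy n hn).1)
  obtain ⟨C, hC, hb⟩ := h.exists_le
  have hε : 0 < η / (2 * C) := by positivity
  obtain ⟨n, ⟨hn1, x, hx, hd⟩, hn3⟩ :=
    (((Metric.tendsto_nhds.1 hlim _ hε).and (hz _ hε)).and hcon).exists
  refine (hy n hn3).2 ⟨x, hx, ?_⟩
  have h2 : dist (y n) x < η / C := by
    have := dist_triangle (y n) z x
    have e : η / C = η / (2 * C) + η / (2 * C) := by field_simp; ring
    linarith
  calc τ (y n - x) ≤ C * dist (y n) x := by rw [dist_eq_norm]; exact hb _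
    _ < C * (η / C) := by gcongr
    _ = η := by field_simp

lemma limSet_connected {𝒰 : Ultrafilter ℕ} {S : ℕ → Set P2} {R : ℝ}
    (hS : ∀ n, S n ⊆ Metric.closedBall 0 R) {a b : ℕ → P2} {x y : P2}
    (ha : Tendsto a 𝒰 (𝓝 x)) (hb : Tendsto b 𝒰 (𝓝 y))
    (hab : ∀ᶠ n in (𝒰 : Filter ℕ), b n ∈ connectedComponentIn (S n) (a n)) :
    y ∈ connectedComponentIn (limSet 𝒰 S) x := by
  have haS : ∀ᶠ n in (𝒰 : Filter ℕ), a n ∈ S n := hab.mono fun n hn =>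
    connectedComponentIn_nonempty_iff.1 ⟨_, hn⟩
  have hbS : ∀ᶠ n in (𝒰 : Filter ℕ), b n ∈ S n := hab.mono fun n hn =>
    connectedComponentIn_subset _ _ hn
  have hx := mem_limSet haS ha
  have hy := mem_limSet hbS hb
  have hc := limSet_compact (𝒰 := 𝒰) hS
  set F := limSet 𝒰 S with hF
  by_contra hcon
  have : CompactSpace F := isCompact_iff_compactSpace.1 hc
  have hny : (⟨y, hy⟩ : F) ∉ connectedComponent (⟨x, hx⟩ : F) := by
    intro h1
    apply hcon
    rw [connectedComponentIn_eq_image hx]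
    exact ⟨_, h1, rfl⟩
  rw [connectedComponent_eq_iInter_isClopen] at hny
  simp only [Set.mem_iInter, not_forall] at hny
  obtain ⟨⟨Z, hZ, hxZ⟩, hyZ⟩ := hny
  have hA : IsCompact ((↑) '' Z : Set P2) := hZ.1.isCompact.image continuous_subtype_val
  have hB : IsCompact ((↑) '' Zᶜ : Set P2) := hZ.compl.1.isCompact.image continuous_subtype_val
  have hdis : Disjoint ((↑) '' Z : Set P2) ((↑) '' Zᶜ : Set P2) :=
    (Set.disjoint_image_iff Subtype.val_injective).2 disjoint_compl_right
  obtain ⟨U, V, hU, hV, hAU, hBV, hUV⟩ := SeparatedNhds.of_isCompact_isCompact hA hB hdis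
  have hcov : F ⊆ U ∪ V := by
    intro z hz
    by_cases hzZ : (⟨z, hz⟩ : F) ∈ Z
    · exact Or.inl (hAU ⟨_, hzZ, rfl⟩)
    · exact Or.inr (hBV ⟨_, hzZ, rfl⟩)
  have hxU : x ∈ U := hAU ⟨_, hxZ, rfl⟩
  have hyV : y ∈ V := hBV ⟨_, hyZ, rfl⟩
  obtain ⟨n, ⟨⟨⟨h1, h2⟩, h3⟩, h4⟩, h5⟩ :=
    (((((ha.eventually (hU.mem_nhds hxU)).and (hb.eventually (hV.mem_nhds hyV))).and
      (limSet_open hS (hU.union hV) hcov)).and hab).and haS).exists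
  have hsub : connectedComponentIn (S n) (a n) ⊆ U :=
    IsPreconnected.subset_left_of_subset_union hU hV hUV
      ((connectedComponentIn_subset _ _).trans h3)
      ⟨a n, mem_connectedComponentIn h5, h1⟩ isPreconnected_connectedComponentIn
  exact Set.disjoint_left.1 hUV (hsub h4) h2

/-! ### Competitors -/

lemma seg_bound {τ : P2 → ℝ} (h : IsNorm τ) {G : Set P2} (hG : IsCompact G) {M r : ℕ}
    (a b : Fin M → P2) (ha : ∀ i, a i ∈ G) (Ep : Fin r → Set P2) (hne : ∀ k, (Ep k).Nonempty)
    (hEp : ∀ k, Ep k ⊆ Set.range b)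
    (hab : ∀ k i j, b i ∈ Ep k → b j ∈ Ep k → a j ∈ connectedComponentIn G (a i)) :
    tauMin τ Ep ≤ tauLen τ G + ∑ i, ENNReal.ofReal (τ (a i - b i)) := by
  let G' : Set P2 := G ∪ ⋃ i, segment ℝ (a i) (b i)
  have hGG' : G ⊆ G' := Set.subset_union_left
  have hsegG' : ∀ i, segment ℝ (a i) (b i) ⊆ G' := fun i =>
    (Set.subset_iUnion (fun i => segment ℝ (a i) (b i)) i).trans Set.subset_union_right
  have hseg : ∀ i, b i ∈ connectedComponentIn G' (a i) := fun i =>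
    (convex_segment (𝕜 := ℝ) (a i) (b i)).isPreconnected.subset_connectedComponentIn
      (left_mem_segment ℝ _ _) (hsegG' i) (right_mem_segment ℝ _ _)
  have hmem : G' ∈ OmegaSet Ep := by
    refine ⟨hG.union (isCompact_iUnion fun i => ?_), fun k => ?_⟩
    · rw [segment_eq_image]
      exact isCompact_Icc.image (by fun_prop)
    · obtain ⟨x, hx⟩ := hne k
      obtain ⟨i, rfl⟩ := hEp k hx
      refine ⟨a i, hGG' (ha i), ?_⟩
      intro y hy
      obtain ⟨j, rfl⟩ := hEp k hy
      have h1 := connectedComponentIn_mono (a i) hGG' (hab k i j hx hy)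
      rw [connectedComponentIn_eq h1]
      exact hseg j
  refine (iInf₂_le G' hmem).trans ?_
  refine (tauLen_union h _ _).trans ?_
  gcongr
  refine (tauLen_iUnion h _).trans ?_
  simp only [tauLen_segment h]
  exact le_rfl

lemma exists_enum {E : Set P2} (hE : E.Finite) (hne : E.Nonempty) {M : ℕ} (hM : E.ncard ≤ M) :
    ∃ e : Fin M → P2, Set.range e = E := by
  have := hE.fintype
  have : Nonempty E := hne.to_subtype
  have hc : Fintype.card E ≤ Fintype.card (Fin M) := by
    rw [Fintype.card_fin, ← Nat.card_eq_fintype_card]; exact hM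
  obtain ⟨g⟩ := Function.Embedding.nonempty_of_card_le hc
  refine ⟨fun i => (Function.invFun g i : E), ?_⟩
  have hs := Function.invFun_surjective g.injective
  ext x
  constructor
  · rintro ⟨i, rfl⟩; exact Subtype.coe_prop _
  · intro hx
    obtain ⟨i, hi⟩ := hs ⟨x, hx⟩
    exact ⟨i, by simp [hi]⟩

lemma exists_partition {E S : Set P2} (hE : E.Finite) (hES : E ⊆ S) :
    ∃ (r : ℕ) (Ep : Fin r → Set P2), IsPartitionOf Ep E ∧
      (∀ j, ∃ x ∈ E, Ep j = connectedComponentIn S x ∩ E) ∧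
      (∀ x ∈ E, ∃ j, Ep j = connectedComponentIn S x ∩ E) := by
  let P : Set (Set P2) := (fun x => connectedComponentIn S x ∩ E) '' E
  have hP : P.Finite := hE.image _
  have := hP.to_subtype
  obtain ⟨r, ⟨g⟩⟩ := Finite.exists_equiv_fin P
  have h1 : ∀ j, ∃ x ∈ E, (g.symm j : Set P2) = connectedComponentIn S x ∩ E := by
    intro j
    obtain ⟨x, hx, hxe⟩ := (g.symm j).2
    exact ⟨x, hx, hxe.symm⟩
  have h2 : ∀ x ∈ E, ∃ j, (g.symm j : Set P2) = connectedComponentIn S x ∩ E := by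
    intro x hx
    exact ⟨g ⟨_, x, hx, rfl⟩, by simp⟩
  refine ⟨r, fun j => g.symm j, ⟨?_, ?_, ?_⟩, h1, h2⟩
  · intro j
    obtain ⟨x, hx, hxe⟩ := h1 j
    refine ⟨x, ?_⟩
    beta_reduce
    rw [hxe]; exact ⟨mem_connectedComponentIn (hES hx), hx⟩
  · intro j k hjk
    rw [Set.disjoint_left]
    intro z hzj hzk
    obtain ⟨x, hx, hxe⟩ := h1 j
    obtain ⟨y, hy, hye⟩ := h1 k
    beta_reduce at hzj hzk
    rw [hxe] at hzj
    rw [hye] at hzk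
    apply hjk
    apply g.symm.injective
    apply Subtype.ext
    rw [hxe, hye, connectedComponentIn_eq hzj.1, connectedComponentIn_eq hzk.1]
  · ext z
    simp only [Set.mem_iUnion]
    constructor
    · rintro ⟨j, hj⟩
      obtain ⟨x, hx, hxe⟩ := h1 j
      rw [hxe] at hj; exact hj.2
    · intro hz
      obtain ⟨j, hj⟩ := h2 z hz
      exact ⟨j, by rw [hj]; exact ⟨mem_connectedComponentIn (hES hz), hz⟩⟩

/-! ### The case `m = 1` -/

lemma empty_mem {τ : P2 → ℝ} (h : IsNorm τ) (M : ℕ) (m : ℝ) : ∅ ∈ OmegaMinMm τ M m := by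
  have hmem : (∅ : Set P2) ∈ OmegaSet (Fin.elim0 : Fin 0 → Set P2) :=
    ⟨isCompact_empty, fun j => j.elim0⟩
  refine ⟨∅, 0, Fin.elim0, by simp, by simp, by simp,
    ⟨fun j => j.elim0, fun j => j.elim0, by simp⟩, ⟨hmem, ?_⟩, by simp⟩
  rw [tauLen_empty h]
  refine le_antisymm zero_le ?_
  exact (iInf₂_le ∅ hmem).trans (tauLen_empty h).le

lemma qbox_norm {m : ℝ} {x : P2} (hx : x ∈ frontier (Qbox m)) : ‖x‖ ≤ m := by
  have hcl : IsClosed (Qbox m) := isClosed_Icc.prod isClosed_Icc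
  obtain ⟨⟨h1, h2⟩, h3, h4⟩ := hcl.frontier_subset hx
  rw [Prod.norm_def, max_le_iff, Real.norm_eq_abs, Real.norm_eq_abs, abs_le, abs_le]
  exact ⟨⟨h1, h2⟩, h3, h4⟩

lemma frontier_compact (m : ℝ) : IsCompact (frontier (Qbox m)) := by
  have hc : IsCompact (Qbox m) := isCompact_Icc.prod isCompact_Icc
  exact hc.of_isClosed_subset isClosed_frontier hc.isClosed.frontier_subset

lemma core {τ : P2 → ℝ} (h : IsNorm τ) (M : ℕ) {δ : ℝ} (hδ : 0 < δ) :
    ∃ κ : ℝ, 0 < κ ∧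
      ∀ E : Set P2, E ⊆ frontier (Qbox 1) → E.Finite → E.ncard ≤ M →
        ∀ (r : ℕ) (Ep : Fin r → Set P2), IsPartitionOf Ep E →
          ∀ S ∈ OmegaSet Ep,
            (∀ x ∈ S, (connectedComponentIn S x ∩ E).Nonempty) →
            tauLen τ S ≤ tauMin τ Ep + ENNReal.ofReal κ →
            ∃ F ∈ OmegaMinMm τ M 1, dTau τ S F < ENNReal.ofReal δ := by
  by_contra hcon
  push Not at hcon
  have hconSeq := fun n : ℕ => hcon (1 / ((n : ℝ) + 1)) Nat.one_div_pos_of_nat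
  choose E hEfr hEfin hEcard r Ep hpart S hSΩ hSE hSlen hbad using hconSeq
  -- nonemptiness
  have hSne : ∀ n, (S n).Nonempty := by
    intro n
    by_contra hne
    rw [Set.not_nonempty_iff_eq_empty] at hne
    have := hbad n ∅ (empty_mem h M 1)
    rw [hne] at this
    simp [dTau] at this
    linarith
  have hEne : ∀ n, (E n).Nonempty := fun n => by
    obtain ⟨x, hx⟩ := hSne n
    exact (hSE n x hx).mono Set.inter_subset_right
  choose e he using fun n => exists_enum (hEfin n) (hEne n) (hEcard n)
  have hefr : ∀ n i, e n i ∈ frontier (Qbox 1) := fun n i => hEfr n (by rw [← he n]; exact ⟨i, rfl⟩)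
  have heE : ∀ n i, e n i ∈ E n := fun n i => by rw [← he n]; exact ⟨i, rfl⟩
  have hEpE : ∀ n k, Ep n k ⊆ E n := fun n k => by
    rw [← (hpart n).2.2]; exact Set.subset_iUnion _ k
  have heS : ∀ n i, e n i ∈ S n := by
    intro n i
    have h1 := heE n i
    rw [← (hpart n).2.2] at h1
    obtain ⟨k, hk⟩ := Set.mem_iUnion.1 h1
    obtain ⟨x, hx, hsub⟩ := (hSΩ n).2 k
    exact connectedComponentIn_subset _ _ (hsub hk)
  -- uniform bounds
  obtain ⟨C, hC, hCb⟩ := h.exists_le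
  obtain ⟨c, hc, hcb⟩ := h.exists_ge
  have hmin : ∀ n, tauMin τ (Ep n) ≤ ENNReal.ofReal (M * C) := by
    intro n
    have h1 := seg_bound h (isCompact_singleton (x := (0 : P2))) (fun _ : Fin M => (0 : P2)) (e n)
      (by simp) (Ep n) (hpart n).1 (fun k => by rw [he n]; exact hEpE n k)
      (fun _ _ _ _ _ => mem_connectedComponentIn (by simp))
    have h2 : tauLen τ {(0 : P2)} = 0 := by
      rw [← segment_same ℝ (0 : P2), tauLen_segment h]; simp [h.zero]
    rw [h2, zero_add] at h1
    refine h1.trans ?_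
    calc ∑ i : Fin M, ENNReal.ofReal (τ (0 - e n i)) ≤ ∑ i : Fin M, ENNReal.ofReal C := by
          refine Finset.sum_le_sum fun i _ => ENNReal.ofReal_le_ofReal ?_
          refine (hCb _).trans ?_
          have := qbox_norm (hefr n i)
          rw [zero_sub, norm_neg]
          nlinarith
      _ = ENNReal.ofReal (M * C) := by
          rw [ENNReal.ofReal_mul (by positivity)]; simp
  have hlen : ∀ n, tauLen τ (S n) ≤ ENNReal.ofReal (M * C + 1) := by
    intro n
    rw [ENNReal.ofReal_add (by positivity) zero_le_one]
    refine (hSlen n).trans (add_le_add (hmin n) (ENNReal.ofReal_le_ofReal ?_))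
    rw [div_le_one (by positivity)]
    linarith [Nat.cast_nonneg (α := ℝ) n]
  have hball : ∀ n, S n ⊆ Metric.closedBall 0 (1 + c * (M * C + 1)) := by
    intro n x hx
    obtain ⟨y, hy, hyE⟩ := hSE n x hx
    have h1 := (tauLen_dist h hy).trans (hlen n)
    rw [ENNReal.ofReal_le_ofReal_iff (by positivity)] at h1
    rw [mem_closedBall_zero_iff]
    have h2 := qbox_norm (hEfr n hyE)
    have h3 : ‖x‖ ≤ ‖y‖ + ‖y - x‖ := by
      have := norm_sub_le y (y - x)
      simpa using this
    have h4 : ‖y - x‖ ≤ c * (M * C + 1) := (hcb _).trans (by gcongr)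
    linarith
  -- the limit
  let 𝒰 : Ultrafilter ℕ := Filter.hyperfilter ℕ
  have h𝒰 : (𝒰 : Filter ℕ) ≤ atTop := Nat.hyperfilter_le_atTop
  set F := limSet 𝒰 S with hF
  have hFc : IsCompact F := limSet_compact hball
  have hlim : ∀ i, ∃ z ∈ frontier (Qbox 1), Tendsto (fun n => e n i) 𝒰 (𝓝 z) := fun i =>
    ultra_lim 𝒰 (frontier_compact 1) (Eventually.of_forall fun n => hefr n i)
  choose f hffr hflim using hlim
  have hfF : ∀ i, f i ∈ F := fun i => mem_limSet (Eventually.of_forall fun n => heS n i) (hflim i)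
  have hrfin : (Set.range f).Finite := Set.finite_range f
  obtain ⟨r', Ep', hpart', hEp1, hEp2⟩ := exists_partition hrfin
    (show Set.range f ⊆ F by rintro _ ⟨i, rfl⟩; exact hfF i)
  have hFΩ : F ∈ OmegaSet Ep' := by
    refine ⟨hFc, fun j => ?_⟩
    obtain ⟨x, ⟨i, rfl⟩, hxe⟩ := hEp1 j
    exact ⟨f i, hfF i, by rw [hxe]; exact Set.inter_subset_left⟩
  -- components of the limit
  have hFE : ∀ x ∈ F, (connectedComponentIn F x ∩ Set.range f).Nonempty := by
    intro x hx
    choose y hyS hyd using fun n => (hSΩ n).1.exists_infDist_eq_dist (hSne n) x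
    have hylim : Tendsto y 𝒰 (𝓝 x) := by
      rw [Metric.tendsto_nhds]
      intro ε hε
      filter_upwards [hx ε hε] with n hn
      obtain ⟨z, hz, hd⟩ := hn
      rw [dist_comm, ← hyd n]
      exact lt_of_le_of_lt (Metric.infDist_le_dist_of_mem hz) hd
    have hex : ∀ n, ∃ i, e n i ∈ connectedComponentIn (S n) (y n) := by
      intro n
      obtain ⟨z, hz, hzE⟩ := hSE n (y n) (hyS n)
      rw [← he n] at hzE
      obtain ⟨i, rfl⟩ := hzE
      exact ⟨i, hz⟩
    have hi : ∃ i, ∀ᶠ n in (𝒰 : Filter ℕ), e n i ∈ connectedComponentIn (S n) (y n) := by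
      by_contra hno
      push Not at hno
      have h1 : ∀ i, ∀ᶠ n in (𝒰 : Filter ℕ), ¬ e n i ∈ connectedComponentIn (S n) (y n) :=
        fun i => Ultrafilter.eventually_not.2 (by simpa using hno i)
      obtain ⟨n, hn⟩ := (eventually_all.2 h1).exists
      obtain ⟨i, hi⟩ := hex n
      exact hn i hi
    obtain ⟨i, hi⟩ := hi
    exact ⟨f i, limSet_connected hball hylim (hflim i) hi, i, rfl⟩
  -- compatibility of the partitions
  have hcomp : ∀ᶠ n in (𝒰 : Filter ℕ), ∀ i j, (∃ k, e n i ∈ Ep n k ∧ e n j ∈ Ep n k) →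
      f j ∈ connectedComponentIn F (f i) := by
    rw [eventually_all]; intro i
    rw [eventually_all]; intro j
    by_cases hij : f j ∈ connectedComponentIn F (f i)
    · exact Eventually.of_forall fun _ _ => hij
    · have h1 : ∀ᶠ n in (𝒰 : Filter ℕ), ¬ ∃ k, e n i ∈ Ep n k ∧ e n j ∈ Ep n k := by
        rw [Ultrafilter.eventually_not]
        intro h2
        apply hij
        refine limSet_connected hball (hflim i) (hflim j) (h2.mono ?_)
        rintro n ⟨k, hk1, hk2⟩
        obtain ⟨x, hx, hsub⟩ := (hSΩ n).2 k
        rw [← connectedComponentIn_eq (hsub hk1)]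
        exact hsub hk2
      exact h1.mono fun n hn hk => absurd hk hn
  -- minimality
  have hmain : ∀ G ∈ OmegaSet Ep', tauLen τ F ≤ tauLen τ G := by
    intro G hG
    rcases eq_or_ne (tauLen τ G) ⊤ with htop | hfin
    · rw [htop]; exact le_top
    have hfG : ∀ i j, f j ∈ connectedComponentIn F (f i) → f j ∈ connectedComponentIn G (f i) := by
      intro i j hij
      obtain ⟨l, hl⟩ := hEp2 (f i) ⟨i, rfl⟩
      obtain ⟨x, hx, hsub⟩ := hG.2 l
      have hi : f i ∈ Ep' l := by rw [hl]; exact ⟨mem_connectedComponentIn (hfF i), i, rfl⟩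
      have hj : f j ∈ Ep' l := by rw [hl]; exact ⟨hij, j, rfl⟩
      rw [← connectedComponentIn_eq (hsub hi)]
      exact hsub hj
    have hfGm : ∀ i, f i ∈ G := fun i =>
      connectedComponentIn_subset _ _ (hfG i i (mem_connectedComponentIn (hfF i)))
    have herr : Tendsto (fun n => ∑ i, τ (f i - e n i) + 1 / ((n : ℝ) + 1)) 𝒰 (𝓝 0) := by
      have h1 : Tendsto (fun n : ℕ => 1 / ((n : ℝ) + 1)) 𝒰 (𝓝 0) :=
        tendsto_one_div_add_atTop_nhds_zero_nat.mono_left h𝒰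
      have h2 : Tendsto (fun n => ∑ i, τ (f i - e n i)) 𝒰 (𝓝 (∑ i : Fin M, (0 : ℝ))) := by
        refine tendsto_finsetSum _ fun i _ => ?_
        have h3 : Tendsto (fun n => f i - e n i) 𝒰 (𝓝 (f i - f i)) :=
          tendsto_const_nhds.sub (hflim i)
        rw [sub_self] at h3
        have := (h.continuous.tendsto 0).comp h3
        rwa [h.zero] at this
      simpa using h2.add h1
    refine ENNReal.le_of_forall_pos_le_add fun ε hε _ => ?_
    have hε' : (0 : ℝ) < ε := hε
    set g := (tauLen τ G).toReal with hg
    have hg0 : 0 ≤ g := ENNReal.toReal_nonneg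
    have hgG : tauLen τ G = ENNReal.ofReal g := (ENNReal.ofReal_toReal hfin).symm
    rw [hgG, ← ENNReal.ofReal_coe_nnreal, ← ENNReal.ofReal_add hg0 hε'.le]
    refine golab h M fun η hη => ?_
    obtain ⟨n, ⟨hn1, hn2⟩, hn3⟩ := (((limSet_thick h (𝒰 := 𝒰) hball hη).and hcomp).and
      (herr.eventually (gt_mem_nhds hε'))).exists
    refine ⟨S n, (hEfin n).toFinset, (hSΩ n).1, ?_, ?_, ?_, hn1⟩
    · rw [← Set.ncard_eq_toFinset_card _ (hEfin n)]; exact hEcard n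
    · simpa using hSE n
    · refine lt_of_le_of_lt (hSlen n) ?_
      have h1 := seg_bound h hG.1 f (e n) hfGm (Ep n) (hpart n).1
        (fun k => by rw [he n]; exact hEpE n k)
        (fun k i j hi hj => hfG i j (hn2 i j ⟨k, hi, hj⟩))
      rw [hgG, ← ENNReal.ofReal_sum_of_nonneg (fun i _ => h.nonneg _),
        ← ENNReal.ofReal_add hg0 (Finset.sum_nonneg fun i _ => h.nonneg _)] at h1
      refine lt_of_le_of_lt (add_le_add_left h1 _) ?_
      rw [← ENNReal.ofReal_add (add_nonneg hg0 (Finset.sum_nonneg fun i _ => h.nonneg _))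
        (by positivity)]
      rw [ENNReal.ofReal_lt_ofReal_iff (by linarith)]
      linarith
  have hFmem : F ∈ OmegaMinMm τ M 1 := by
    refine ⟨Set.range f, r', Ep', ?_, hrfin, ?_, hpart', ⟨hFΩ, ?_⟩, hFE⟩
    · rintro _ ⟨i, rfl⟩; exact hffr i
    · rw [← Set.image_univ]
      refine (Set.ncard_image_le Set.finite_univ).trans ?_
      simp
    · exact le_antisymm (le_iInf₂ hmain) (iInf₂_le F hFΩ)
  obtain ⟨n, hn⟩ := (limSet_open (𝒰 := 𝒰) hball (thick_isOpen h (δ / 2) F) (by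
    intro x hx; exact ⟨x, hx, by simp [h.zero, hδ]⟩)).exists
  have h1 := hbad n F hFmem
  have h2 : dTau τ (S n) F ≤ ENNReal.ofReal (δ / 2) := by
    refine iSup₂_le fun a ha => ?_
    obtain ⟨b, hb, hab⟩ := hn ha
    exact iInf₂_le_of_le b hb (ENNReal.ofReal_le_ofReal hab.le)
  have h3 := h1.trans h2
  rw [ENNReal.ofReal_le_ofReal_iff (by linarith)] at h3
  linarith

/-! ### Scaling -/

section Scaling
open scoped Pointwise

lemma smul_cc {c : ℝ} (hc : c ≠ 0) {S : Set P2} {x : P2} (hx : x ∈ S) :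
    c • connectedComponentIn S x = connectedComponentIn (c • S) (c • x) :=
  (Homeomorph.smulOfNeZero c hc : P2 ≃ₜ P2).image_connectedComponentIn hx

lemma smul_omega {c : ℝ} (hc : c ≠ 0) {r : ℕ} {Ep : Fin r → Set P2} {S : Set P2}
    (hS : S ∈ OmegaSet Ep) : c • S ∈ OmegaSet (fun j => c • Ep j) := by
  refine ⟨hS.1.smul c, fun j => ?_⟩
  obtain ⟨x, hx, hsub⟩ := hS.2 j
  refine ⟨c • x, Set.smul_mem_smul_set hx, ?_⟩
  rw [← smul_cc hc hx]
  exact Set.smul_set_mono hsub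

lemma tauMin_smul_le {τ : P2 → ℝ} (h : IsNorm τ) {c : ℝ} (hc : 0 < c) {r : ℕ}
    (Ep : Fin r → Set P2) :
    tauMin τ (fun j => c • Ep j) ≤ ENNReal.ofReal c * tauMin τ Ep := by
  have : tauMin τ Ep = ⨅ S : OmegaSet Ep, tauLen τ S := iInf_subtype'
  rw [this, ENNReal.mul_iInf_of_ne (by simpa using hc) ENNReal.ofReal_ne_top]
  refine le_iInf fun S => ?_
  rw [← tauLen_smul h hc]
  exact iInf₂_le _ (smul_omega hc.ne' S.2)

lemma tauMin_smul {τ : P2 → ℝ} (h : IsNorm τ) {c : ℝ} (hc : 0 < c) {r : ℕ}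
    (Ep : Fin r → Set P2) :
    tauMin τ (fun j => c • Ep j) = ENNReal.ofReal c * tauMin τ Ep := by
  refine le_antisymm (tauMin_smul_le h hc Ep) ?_
  have h1 := tauMin_smul_le h (inv_pos.2 hc) (fun j => c • Ep j)
  simp only [inv_smul_smul₀ hc.ne'] at h1
  calc ENNReal.ofReal c * tauMin τ Ep
      ≤ ENNReal.ofReal c * (ENNReal.ofReal c⁻¹ * tauMin τ (fun j => c • Ep j)) := by gcongr
    _ = tauMin τ (fun j => c • Ep j) := by
      rw [← mul_assoc, ← ENNReal.ofReal_mul hc.le, mul_inv_cancel₀ hc.ne', ENNReal.ofReal_one,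
        one_mul]

lemma smul_qbox {c : ℝ} (hc : 0 < c) (m : ℝ) : c • Qbox m = Qbox (c * m) := by
  ext x
  rw [Set.mem_smul_set_iff_inv_smul_mem₀ hc.ne']
  simp only [Qbox, Set.mem_prod, Set.mem_Icc, Prod.smul_fst, Prod.smul_snd, smul_eq_mul]
  have h1 : ∀ t : ℝ, (-m ≤ c⁻¹ * t ↔ -(c * m) ≤ t) := fun t => by
    rw [inv_mul_eq_div, le_div_iff₀ hc]; constructor <;> intro <;> linarith
  have h2 : ∀ t : ℝ, (c⁻¹ * t ≤ m ↔ t ≤ c * m) := fun t => by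
    rw [inv_mul_eq_div, div_le_iff₀ hc]; constructor <;> intro <;> linarith
  rw [h1, h1, h2, h2]

lemma smul_frontier {c : ℝ} (hc : 0 < c) (m : ℝ) :
    c • frontier (Qbox m) = frontier (Qbox (c * m)) := by
  rw [← smul_qbox hc]
  exact (Homeomorph.smulOfNeZero c hc.ne' : P2 ≃ₜ P2).image_frontier _

lemma smul_partition {c : ℝ} (hc : c ≠ 0) {r : ℕ} {Ep : Fin r → Set P2} {E : Set P2}
    (hp : IsPartitionOf Ep E) : IsPartitionOf (fun j => c • Ep j) (c • E) := by
  refine ⟨fun j => (hp.1 j).smul_set, fun j k hjk => ?_, ?_⟩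
  · exact (Set.disjoint_image_iff (smul_right_injective P2 hc)).2 (hp.2.1 j k hjk)
  · rw [← hp.2.2, Set.smul_set_iUnion]

lemma smul_comps {c : ℝ} (hc : c ≠ 0) {S E : Set P2}
    (hS : ∀ x ∈ S, (connectedComponentIn S x ∩ E).Nonempty) :
    ∀ x ∈ c • S, (connectedComponentIn (c • S) x ∩ c • E).Nonempty := by
  rintro _ ⟨x, hx, rfl⟩
  obtain ⟨y, hy, hyE⟩ := hS x hx
  refine ⟨c • y, ?_, Set.smul_mem_smul_set hyE⟩
  have := smul_cc hc hx
  exact this ▸ Set.smul_mem_smul_set hy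

lemma smul_ncard {c : ℝ} (hc : c ≠ 0) (E : Set P2) : (c • E).ncard = E.ncard :=
  Set.ncard_image_of_injective E (smul_right_injective P2 hc)

lemma smul_minMm {τ : P2 → ℝ} (h : IsNorm τ) {c : ℝ} (hc : 0 < c) {M : ℕ} {m : ℝ} {F : Set P2}
    (hF : F ∈ OmegaMinMm τ M m) : c • F ∈ OmegaMinMm τ M (c * m) := by
  obtain ⟨E, r, Ep, h1, h2, h3, h4, ⟨h5, h6⟩, h7⟩ := hF
  refine ⟨c • E, r, fun j => c • Ep j, ?_, h2.smul_set, ?_, smul_partition hc.ne' h4,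
    ⟨smul_omega hc.ne' h5, ?_⟩, smul_comps hc.ne' h7⟩
  · rw [← smul_frontier hc]; exact Set.smul_set_mono h1
  · rw [smul_ncard hc.ne']; exact h3
  · rw [tauLen_smul h hc, tauMin_smul h hc, h6]

lemma dTau_smul_le {τ : P2 → ℝ} (h : IsNorm τ) {c : ℝ} (hc : 0 < c) (A B : Set P2) :
    dTau τ (c • A) (c • B) ≤ ENNReal.ofReal c * dTau τ A B := by
  refine iSup₂_le ?_
  rintro _ ⟨a, ha, rfl⟩
  have h1 : (⨅ b ∈ B, ENNReal.ofReal (τ (a - b))) ≤ dTau τ A B :=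
    le_iSup₂ (f := fun a (_ : a ∈ A) => ⨅ b ∈ B, ENNReal.ofReal (τ (a - b))) a ha
  refine le_trans ?_ (mul_le_mul_right h1 _)
  have h2 : (⨅ b ∈ B, ENNReal.ofReal (τ (a - b))) = ⨅ b : B, ENNReal.ofReal (τ (a - b)) :=
    iInf_subtype'
  rw [h2, ENNReal.mul_iInf_of_ne (by simpa using hc) ENNReal.ofReal_ne_top]
  refine le_iInf fun b => ?_
  refine iInf₂_le_of_le (c • (b : P2)) (Set.smul_mem_smul_set b.2) ?_
  rw [← ENNReal.ofReal_mul hc.le]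
  simp only
  rw [← smul_sub, h.smul_eq, abs_of_pos hc]

lemma full {τ : P2 → ℝ} (h : IsNorm τ) (M : ℕ)
    (δ₂ : ℝ) (hδ₂ : 0 < δ₂) :
    ∃ κ₂ : ℝ, 0 < κ₂ ∧
      ∀ m : ℝ, 0 < m → ∀ E : Set P2, E ⊆ frontier (Qbox m) → E.Finite → E.ncard ≤ M →
        ∀ (r : ℕ) (Ep : Fin r → Set P2), IsPartitionOf Ep E →
          ∀ S ∈ OmegaSet Ep,
            (∀ x ∈ S, (connectedComponentIn S x ∩ E).Nonempty) →
            tauLen τ S ≤ tauMin τ Ep + ENNReal.ofReal (κ₂ * m) →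
            ∃ F ∈ OmegaMinMm τ M m, dTau τ S F < ENNReal.ofReal (δ₂ * m) := by
  obtain ⟨κ, hκ, H⟩ := core h M hδ₂
  refine ⟨κ, hκ, ?_⟩
  intro m hm E hE hEf hEM r Ep hp S hS hSE hlen
  have hc : 0 < m⁻¹ := inv_pos.2 hm
  obtain ⟨F, hF, hd⟩ := H (m⁻¹ • E) (by
      have := Set.smul_set_mono (a := m⁻¹) hE
      rwa [smul_frontier hc, inv_mul_cancel₀ hm.ne'] at this) hEf.smul_set
    (by rw [smul_ncard hc.ne']; exact hEM) r (fun j => m⁻¹ • Ep j) (smul_partition hc.ne' hp)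
    (m⁻¹ • S) (smul_omega hc.ne' hS) (smul_comps hc.ne' hSE) (by
      rw [tauLen_smul h hc, tauMin_smul h hc]
      refine (mul_le_mul_right hlen _).trans ?_
      rw [mul_add, ← ENNReal.ofReal_mul hc.le]
      gcongr
      apply le_of_eq
      field_simp)
  refine ⟨m • F, by simpa using smul_minMm h hm hF, ?_⟩
  have h1 := dTau_smul_le h hm (m⁻¹ • S) F
  rw [smul_inv_smul₀ hm.ne'] at h1
  refine lt_of_le_of_lt h1 ?_
  rw [mul_comm δ₂, ENNReal.ofReal_mul hm.le]
  exact ENNReal.mul_lt_mul_right (by simpa using hm) ENNReal.ofReal_ne_top hd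

end Scaling

end Limits

/-- (Stability of Steiner forests.) For a strictly convex norm `τ`,
`M ∈ ℕ` and `δ₂ > 0`, there exists `κ₂ > 0` (depending only on `δ₂, M, τ`) such that for
every `m > 0`, every `E ⊆ ∂Q_m` with `|E| ≤ M`, every partition `E̲` of `E` and every
`S ∈ Ω_{E̲}` whose components all meet `E`: if `τ(S) ≤ τ_{E̲} + κ₂ m` then there is
`F ∈ Ω^min_{M,m}` with `d_τ(S,F) < δ₂ m`. -/
theorem statement15 (τ : P2 → ℝ) (hτ : IsStrictlyConvexNorm τ) (M : ℕ)
    (δ₂ : ℝ) (hδ₂ : 0 < δ₂) :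
    ∃ κ₂ : ℝ, 0 < κ₂ ∧
      ∀ m : ℝ, 0 < m → ∀ E : Set P2, E ⊆ frontier (Qbox m) → E.Finite → E.ncard ≤ M →
        ∀ (r : ℕ) (Ep : Fin r → Set P2), IsPartitionOf Ep E →
          ∀ S ∈ OmegaSet Ep,
            (∀ x ∈ S, (connectedComponentIn S x ∩ E).Nonempty) →
            tauLen τ S ≤ tauMin τ Ep + ENNReal.ofReal (κ₂ * m) →
            ∃ F ∈ OmegaMinMm τ M m, dTau τ S F < ENNReal.ofReal (δ₂ * m) := by
  exact full hτ.1 M δ₂ hδ₂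
end

section
/- Let τ be a strictly convex norm on ℝ² and let E ⊂ ℝ² be a nonempty finite set. If T ⊆ ℝ² is a compact connected set containing E whose one-dimensional τ-Hausdorff measure is minimal among all compact connected sets containing E, then T is contained in the closed convex hull of E. -/
open scoped ENNReal

namespace St16

open MeasureTheory Measure Set Topology
open scoped ENNReal


lemma bump {X : Type*} [MetricSpace X] {K : Set X} (hK : IsCompact K) (hKc : IsPreconnected K)
    {φ : X → ℝ} (hφ : Continuous φ) {c : ℝ} {z y : X} (hz : z ∈ K) (hy : y ∈ K)
    (hzc : c ≤ φ z) (hyc : φ y ≤ c) :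
    ∃ C ⊆ K, IsCompact C ∧ IsPreconnected C ∧ z ∈ C ∧ (∀ x ∈ C, c ≤ φ x) ∧ ∃ w ∈ C, φ w = c := by
  set A : Set X := K ∩ {x | c ≤ φ x} with hA
  have hAc : IsCompact A := hK.inter_right (isClosed_le continuous_const hφ)
  have : CompactSpace A := isCompact_iff_compactSpace.1 hAc
  let z' : A := ⟨z, hz, hzc⟩
  let C : Set X := Subtype.val '' (connectedComponent z')
  have hCA : C ⊆ A := by rintro _ ⟨a, -, rfl⟩; exact a.2
  refine ⟨C, fun x hx => (hCA hx).1, ?_, ?_, ⟨z', mem_connectedComponent, rfl⟩,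
    fun x hx => (hCA hx).2, ?_⟩
  · exact isClosed_connectedComponent.isCompact.image continuous_subtype_val
  · exact isPreconnected_connectedComponent.image _ continuous_subtype_val.continuousOn
  by_contra hcon
  push Not at hcon
  have hU : IsOpen {a : A | φ a ≠ c} :=
    isOpen_ne_fun (hφ.comp continuous_subtype_val) continuous_const
  have hsub : connectedComponent z' ⊆ {a : A | φ a ≠ c} := fun a ha => hcon a ⟨a, ha, rfl⟩
  rw [connectedComponent_eq_iInter_isClopen] at hsub
  have : Nonempty { s : Set A // IsClopen s ∧ z' ∈ s } := ⟨⟨univ, isClopen_univ, mem_univ _⟩⟩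
  obtain ⟨⟨Z, hZ, hzZ⟩, hZU⟩ := exists_subset_nhds_of_compactSpace
    (V := fun s : { s : Set A // IsClopen s ∧ z' ∈ s } => (s : Set A))
    (fun s t => ⟨⟨s ∩ t, s.2.1.inter t.2.1, s.2.2, t.2.2⟩, inter_subset_left, inter_subset_right⟩)
    (fun s => s.2.1.1) (fun a ha => hU.mem_nhds (hsub ha))
  have h1 : IsClosed (Subtype.val '' Z : Set X) :=
    (hZ.1.isCompact.image continuous_subtype_val).isClosed
  have h2 : IsClosed ((Subtype.val '' Zᶜ : Set X) ∪ {x | φ x ≤ c}) :=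
    ((hZ.2.isClosed_compl.isCompact.image continuous_subtype_val).isClosed).union
      (isClosed_le hφ continuous_const)
  obtain ⟨x, hxK, ⟨a, haZ, hax⟩, hx2⟩ := isPreconnected_closed_iff.1 hKc _ _ h1 h2 (by
      intro x hx
      by_cases hxc : c ≤ φ x
      · by_cases hxZ : (⟨x, hx, hxc⟩ : A) ∈ Z
        · exact Or.inl ⟨_, hxZ, rfl⟩
        · exact Or.inr (Or.inl ⟨_, hxZ, rfl⟩)
      · exact Or.inr (Or.inr (not_le.1 hxc).le))
    ⟨z, hz, z', hzZ, rfl⟩ ⟨y, hy, Or.inr hyc⟩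
  rcases hx2 with ⟨b, hb, hbx⟩ | hx2
  · have : a = b := Subtype.ext (hax.trans hbx.symm)
    exact hb (this ▸ haZ)
  · subst hax
    exact hZU haZ (le_antisymm hx2 a.2.2)

lemma edist_le_measure {X : Type*} [MetricSpace X] [MeasurableSpace X] [BorelSpace X]
    {C : Set X} (hC : IsPreconnected C) {x y : X} (hx : x ∈ C) (hy : y ∈ C) :
    edist x y ≤ μH[1] C := by
  have hL : LipschitzWith 1 (fun z : X => dist x z) := LipschitzWith.dist_right x
  have h1 := hL.hausdorffMeasure_image_le (d := 1) zero_le_one C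
  have hp : IsPreconnected ((fun z : X => dist x z) '' C) := hC.image _ hL.continuous.continuousOn
  have hI : Icc 0 (dist x y) ⊆ (fun z : X => dist x z) '' C :=
    hp.Icc_subset ⟨x, hx, dist_self x⟩ ⟨y, hy, rfl⟩
  have h2 := measure_mono (μ := (μH[1] : Measure ℝ)) hI
  rw [hausdorffMeasure_real] at h1 h2
  rw [Real.volume_Icc, sub_zero, ← edist_dist] at h2
  simpa using h2.trans h1

variable {V : Type*} [NormedAddCommGroup V] [NormedSpace ℝ V] [MeasurableSpace V] [BorelSpace V]

lemma core (f g : V →L[ℝ] ℝ) (u : V) (hg : ∀ w, g w ≤ ‖w‖)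
    (hker : ∀ w, f w = 0 → w = g w • u) (hsc : ∀ w, g w = ‖w‖ → f w = 0)
    (K : Set V) (hK : IsCompact K) (hKc : IsPreconnected K)
    (hub : ∀ B ⊆ K, IsCompact B → ∀ α β : ℝ, (∀ x ∈ B, g x ∈ Icc α β) →
      μH[1] B ≤ ENNReal.ofReal (β - α)) :
    ∀ p ∈ K, ∀ q ∈ K, f p = f q := by
  intro p hp q hq
  obtain ⟨x, hx, hxm⟩ := hK.exists_isMinOn ⟨p, hp⟩ g.continuous.continuousOn
  obtain ⟨y, hy, hym⟩ := hK.exists_isMaxOn ⟨p, hp⟩ g.continuous.continuousOn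
  have hxm : ∀ a ∈ K, g x ≤ g a := fun a ha => hxm ha
  have hym : ∀ a ∈ K, g a ≤ g y := fun a ha => hym ha
  -- points joined by a continuum of g-width equal to their g-difference
  have key : ∀ C ⊆ K, IsCompact C → IsPreconnected C → ∀ w ∈ C, x ∈ C → (∀ a ∈ C, g a ≤ g w) →
      ‖w - x‖ = g w - g x ∧ f (w - x) = 0 := by
    intro C hCK hC hCc w hw hxC hmax
    have h1 := (edist_le_measure hCc hw hxC).trans
      (hub C hCK hC (g x) (g w) fun a ha => ⟨hxm a (hCK ha), hmax a ha⟩)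
    rw [edist_dist, dist_eq_norm,
      ENNReal.ofReal_le_ofReal_iff (sub_nonneg.2 (hxm w (hCK hw)))] at h1
    have h2 := hg (w - x)
    have h3 : g (w - x) = ‖w - x‖ := le_antisymm h2 (by rw [map_sub]; exact h1)
    exact ⟨by rw [← h3, map_sub], hsc _ h3⟩
  obtain ⟨hyx, hfyx⟩ := key K subset_rfl hK hKc y hy hx hym
  suffices h : ∀ z ∈ K, f z = f x from (h p hp).trans (h q hq).symm
  by_contra hcon
  push Not at hcon
  obtain ⟨z, hz, hfz⟩ := hcon
  have hpos : 0 < |f z - f x| := abs_pos.2 (sub_ne_zero.2 hfz)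
  have hφ : Continuous fun a : V => |f a - f x| := by fun_prop
  obtain ⟨C, hCK, hC, hCc, hzC, hCge, w, hwC, hw⟩ := bump hK hKc hφ (c := |f z - f x| / 2) hz hx
    (by linarith) (by simp only [sub_self, abs_zero]; linarith)
  have hseg : segment ℝ x y ⊆ K := by
    rintro s hs
    rw [segment_eq_image'] at hs
    obtain ⟨t, ⟨ht0, ht1⟩, rfl⟩ := hs
    have hxy := hxm y hy
    obtain ⟨C', hC'K, hC', hC'c, hxC', hC'ge, w', hwC2, hw'⟩ := bump hK hKc
      (φ := fun a => - g a) (by fun_prop) (c := -(g x + t * (g y - g x))) hx hy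
      (by have := mul_nonneg ht0 (sub_nonneg.2 hxy); linarith)
      (by have := mul_nonneg (sub_nonneg.2 ht1) (sub_nonneg.2 hxy); nlinarith)
    have hgw : g w' = g x + t * (g y - g x) := by linarith
    obtain ⟨-, h2⟩ := key C' hC'K hC' hC'c w' hwC2 hxC' (fun a ha => by
      have := hC'ge a ha; linarith)
    have h3 := hker _ h2
    have h4 := hker _ hfyx
    have h5 : w' = x + t • (y - x) := by
      rw [h4, smul_smul]
      rw [map_sub, hgw] at h3
      rw [map_sub, ← sub_eq_iff_eq_add', h3]
      congr 1
      ring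
    simp only
    exact h5 ▸ hC'K hwC2
  have hsegc : IsCompact (segment ℝ x y) := by
    rw [segment_eq_image']
    exact isCompact_Icc.image (by fun_prop)
  have hdisj : Disjoint (segment ℝ x y) C := by
    rw [Set.disjoint_left]
    intro s hs hsC
    rw [segment_eq_image'] at hs
    obtain ⟨t, -, rfl⟩ := hs
    have := hCge _ hsC
    simp only [map_add, map_smul, hfyx] at this
    simp at this
    linarith
  have h1 := hub (segment ℝ x y ∪ C) (union_subset hseg hCK) (hsegc.union hC) (g x) (g y)
    (fun a ha => ⟨hxm a (union_subset hseg hCK ha), hym a (union_subset hseg hCK ha)⟩)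
  rw [measure_union hdisj hC.measurableSet, hausdorffMeasure_segment, edist_comm, edist_dist,
    dist_eq_norm, hyx] at h1
  have h2 : μH[1] C ≤ 0 := by
    refine (ENNReal.add_le_add_iff_left (a := ENNReal.ofReal (g y - g x)) ENNReal.ofReal_ne_top).1 ?_
    simpa using h1
  have h3 := (edist_le_measure hCc hzC hwC).trans h2
  have h4 : z = w := by simpa using h3
  subst h4
  linarith

lemma retract_lip (f g : V →L[ℝ] ℝ) (u : V) (hu : ‖u‖ = 1) (hg : ∀ w, |g w| ≤ ‖w‖)
    (hker : ∀ w, f w = 0 → w = g w • u) (c : ℝ) (x₀ : V) (hx₀ : f x₀ = c) :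
    LipschitzWith 1 (fun y : V => if f y ≤ c then y else x₀ + g (y - x₀) • u) := by
  have hP : ∀ x y : V, dist (x₀ + g (x - x₀) • u) (x₀ + g (y - x₀) • u) ≤ dist x y := by
    intro x y
    rw [dist_add_left, dist_eq_norm, ← sub_smul, norm_smul, hu, mul_one, ← map_sub, dist_eq_norm,
      Real.norm_eq_abs]
    simpa using hg (x - y)
  have hmix : ∀ x y : V, f x ≤ c → c < f y → dist x (x₀ + g (y - x₀) • u) ≤ dist x y := by
    intro x y hx hy
    have hd : 0 < f y - f x := by linarith
    set t := (c - f x) / (f y - f x) with ht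
    have ht0 : 0 ≤ t := div_nonneg (by linarith) hd.le
    have ht1 : t ≤ 1 := (div_le_one hd).2 (by linarith)
    have hz : f (AffineMap.lineMap x y t) = c := by
      rw [AffineMap.lineMap_apply_module']
      simp only [map_add, map_smul, map_sub, smul_eq_mul]
      rw [ht]; field_simp; ring
    have hfix : x₀ + g (AffineMap.lineMap x y t - x₀) • u = AffineMap.lineMap x y t := by
      rw [← hker _ (by rw [map_sub, hz, hx₀, sub_self])]; abel
    have h1 := hP (AffineMap.lineMap x y t) y
    rw [hfix] at h1
    have h2 := dist_triangle x (AffineMap.lineMap x y t) (x₀ + g (y - x₀) • u)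
    have h3 : dist x (AffineMap.lineMap x y t) = t * dist x y := by
      rw [dist_left_lineMap, Real.norm_of_nonneg ht0]
    have h4 : dist (AffineMap.lineMap x y t) y = (1 - t) * dist x y := by
      rw [dist_lineMap_right, Real.norm_of_nonneg (by linarith)]
    linarith
  refine LipschitzWith.of_dist_le_mul fun x y => ?_
  simp only [NNReal.coe_one, one_mul]
  split_ifs with h1 h2 h2
  · exact le_rfl
  · exact hmix x y h1 (not_le.1 h2)
  · rw [dist_comm, dist_comm x y]; exact hmix y x h2 (not_le.1 h1)
  · exact hP x y

theorem abstract_main [FiniteDimensional ℝ V] (hdim : Module.finrank ℝ V = 2)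
    (hsc : ∀ x y : V, ‖x + y‖ = ‖x‖ + ‖y‖ → ∃ c : ℝ, 0 ≤ c ∧ (x = c • y ∨ y = c • x))
    (E : Set V) (hEfin : E.Finite) (hEne : E.Nonempty) (T : Set V) (hTc : IsCompact T)
    (hTconn : IsConnected T) (hET : E ⊆ T)
    (hmin : ∀ T' : Set V, IsCompact T' → IsConnected T' → E ⊆ T' →
      μH[1] T ≤ μH[1] T') :
    T ⊆ closure (convexHull ℝ E) := by
  intro p hpT
  by_contra hp
  obtain ⟨e, he⟩ := hEne
  -- finiteness
  have hfin : μH[1] T ≠ ∞ := by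
    have hT' := hmin (⋃ a ∈ E, segment ℝ e a)
      (hEfin.isCompact_biUnion fun a _ => by
        rw [segment_eq_image']; exact isCompact_Icc.image (by fun_prop))
      ⟨⟨e, mem_biUnion he (left_mem_segment ℝ e e)⟩, by
        rw [← sUnion_image]
        refine isPreconnected_sUnion e _ ?_ ?_
        · rintro _ ⟨a, _, rfl⟩; exact left_mem_segment ℝ e a
        · rintro _ ⟨a, _, rfl⟩; exact (convex_segment e a).isPreconnected⟩
      (fun a ha => mem_biUnion ha (right_mem_segment ℝ e a))
    refine ne_top_of_le_ne_top ?_ (hT'.trans (measure_biUnion_le _ hEfin.countable _))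
    have := hEfin.fintype
    rw [tsum_fintype]
    refine ENNReal.sum_ne_top.2 fun a _ => ?_
    rw [hausdorffMeasure_segment]
    exact edist_ne_top _ _
  obtain ⟨f, c, hfE, hfp⟩ := geometric_hahn_banach_closed_point (convex_convexHull ℝ E).closure
    isClosed_closure hp
  have hfE : ∀ a ∈ E, f a < c := fun a ha => hfE a (subset_closure (subset_convexHull ℝ E ha))
  have hfe := hfE e he
  -- kernel
  have hrange : LinearMap.range (f : V →ₗ[ℝ] ℝ) = ⊤ := by
    rw [LinearMap.range_eq_top]
    refine LinearMap.surjective ?_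
    intro h0
    have h1 : f p = 0 := by simpa using congrArg (fun l : V →ₗ[ℝ] ℝ => l p) h0
    have h2 : f e = 0 := by simpa using congrArg (fun l : V →ₗ[ℝ] ℝ => l e) h0
    linarith
  have hk1 : Module.finrank ℝ (LinearMap.ker (f : V →ₗ[ℝ] ℝ)) = 1 := by
    have := LinearMap.finrank_range_add_finrank_ker (f : V →ₗ[ℝ] ℝ)
    rw [hrange, finrank_top, Module.finrank_self, hdim] at this
    omega
  obtain ⟨v, hv0, hvspan⟩ := finrank_eq_one_iff'.1 hk1
  have hfv : f (v : V) = 0 := v.2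
  have hvn : ‖(v : V)‖ ≠ 0 := by simpa using hv0
  set u : V := ‖(v : V)‖⁻¹ • (v : V) with hu
  have hun : ‖u‖ = 1 := by rw [hu, norm_smul, norm_inv, norm_norm, inv_mul_cancel₀ hvn]
  have hfu : f u = 0 := by rw [hu, map_smul, hfv, smul_zero]
  obtain ⟨g, hgn, hgu⟩ := exists_dual_vector ℝ u (by rw [hun]; exact one_ne_zero)
  have hgu : g u = 1 := by rw [hgu, hun]; simp
  have hg : ∀ w, |g w| ≤ ‖w‖ := fun w => by
    have := g.le_opNorm w
    rwa [hgn, one_mul, Real.norm_eq_abs] at this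
  have hker : ∀ w, f w = 0 → w = g w • u := by
    intro w hw
    obtain ⟨k, hk⟩ := hvspan ⟨w, hw⟩
    have hk : k • (v : V) = w := congrArg Subtype.val hk
    have hw' : w = (k * ‖(v : V)‖) • u := by
      rw [hu, smul_smul, mul_assoc, mul_inv_cancel₀ hvn, mul_one, hk]
    have : g w = k * ‖(v : V)‖ := by rw [hw', map_smul, hgu]; simp [norm_smul, hun]
    rw [this]; exact hw'
  have hscg : ∀ w, g w = ‖w‖ → f w = 0 := by
    intro w hw
    have h1 : ‖u + w‖ = ‖u‖ + ‖w‖ := by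
      refine le_antisymm (norm_add_le _ _) ?_
      have := (le_abs_self _).trans (hg (u + w))
      rwa [map_add, hgu, hw, ← hun] at this
    obtain ⟨k, -, hk | hk⟩ := hsc u w h1
    · have hk0 : k ≠ 0 := by
        rintro rfl
        rw [zero_smul] at hk
        rw [hk, norm_zero] at hun
        exact zero_ne_one hun
      have := congrArg f hk
      rw [hfu, map_smul, smul_eq_mul] at this
      exact (mul_eq_zero.1 this.symm).resolve_left hk0
    · rw [hk, map_smul, hfu, smul_zero]
  obtain ⟨x₀, hx₀⟩ : ∃ x₀, f x₀ = c := (LinearMap.range_eq_top.1 hrange) c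
  have hlip := retract_lip f g u hun hg hker c x₀ hx₀
  set π : V → V := fun y : V => if f y ≤ c then y else x₀ + g (y - x₀) • u with hπ
  have hTπ := hmin (π '' T) (hTc.image hlip.continuous)
    (hTconn.image _ hlip.continuous.continuousOn)
    (fun a ha => ⟨a, hET ha, by simp [hπ, (hfE a ha).le]⟩)
  have hB : ∀ B ⊆ T, (∀ x ∈ B, c < f x) → IsCompact B → ∀ α β : ℝ, (∀ x ∈ B, g x ∈ Icc α β) →
      μH[1] B ≤ ENNReal.ofReal (β - α) := by
    intro B hBT hBc hBk α β hαβ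
    have h1 : μH[1] (π '' T) ≤ μH[1] (T \ B) + μH[1] (π '' B) := by
      calc μH[1] (π '' T) ≤ μH[1] (π '' (T \ B) ∪ π '' B) := by
            refine measure_mono ?_
            rw [← image_union, sdiff_union_of_subset hBT]
        _ ≤ μH[1] (π '' (T \ B)) + μH[1] (π '' B) := measure_union_le _ _
        _ ≤ _ := by
            refine add_le_add ?_ le_rfl
            simpa using hlip.hausdorffMeasure_image_le (d := 1) zero_le_one (T \ B)
    have h2 : μH[1] T = μH[1] (T \ B) + μH[1] B := by
      rw [← measure_union disjoint_sdiff_left hBk.measurableSet, sdiff_union_of_subset hBT]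
    have h3 : μH[1] B ≤ μH[1] (π '' B) := by
      have h4 := hTπ.trans h1
      rw [h2] at h4
      exact (ENNReal.add_le_add_iff_left
        (ne_top_of_le_ne_top hfin (measure_mono sdiff_subset))).1 h4
    rcases B.eq_empty_or_nonempty with rfl | ⟨b, hb⟩
    · simp
    have hab : α ≤ β := (hαβ b hb).1.trans (hαβ b hb).2
    refine h3.trans ((measure_mono (t := segment ℝ (x₀ + (α - g x₀) • u) (x₀ + (β - g x₀) • u))
      ?_).trans ?_)
    · rintro _ ⟨a, ha, rfl⟩
      have hπa : π a = x₀ + g (a - x₀) • u := by simp [hπ, not_le.2 (hBc a ha)]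
      rw [hπa]
      obtain ⟨h5, h6⟩ := hαβ a ha
      have h7 : g a - g x₀ ∈ segment ℝ (α - g x₀) (β - g x₀) := by
        rw [segment_eq_Icc (by linarith)]; constructor <;> linarith
      obtain ⟨s, t, hs, ht, hst, h8⟩ := h7
      refine ⟨s, t, hs, ht, hst, ?_⟩
      rw [map_sub, ← h8]
      simp only [smul_add, smul_smul, add_smul, smul_eq_mul]
      have : x₀ = s • x₀ + t • x₀ := by rw [← add_smul, hst, one_smul]
      calc _ = (s • x₀ + t • x₀) + ((s * (α - g x₀)) • u + (t * (β - g x₀)) • u) := by abel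
        _ = _ := by rw [← this]
    · rw [hausdorffMeasure_segment, edist_dist, dist_add_left, dist_eq_norm, ← sub_smul, norm_smul,
        hun, mul_one, norm_sub_rev, Real.norm_of_nonneg (by linarith)]
      exact ENNReal.ofReal_le_ofReal (by linarith)
  obtain ⟨K, hKT, hK, hKc, hpK, hKge, w, hwK, hw⟩ := bump hTc hTconn.isPreconnected f.continuous
    (c := (c + f p) / 2) hpT (hET he) (by linarith) (by linarith)
  have := core f g u (fun w => (le_abs_self _).trans (hg w)) hker hscg K hK hKc
    (fun B hBK hBk α β h => hB B (hBK.trans hKT)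
      (fun x hx => by have := hKge x (hBK hx); linarith) hBk α β h) p hpK w hwK
  linarith

/-- `ℝ²` with the norm `τ`. -/
def W (τ : P2 → ℝ) (_h : IsNorm τ) : Type := P2

section
variable {τ : P2 → ℝ} {h : IsNorm τ}

instance : AddCommGroup (W τ h) := inferInstanceAs (AddCommGroup P2)
noncomputable instance : Module ℝ (W τ h) := inferInstanceAs (Module ℝ P2)
instance : Norm (W τ h) := ⟨τ⟩

lemma tau_nonneg (h : IsNorm τ) (x : P2) : 0 ≤ τ x := by
  have h1 := h.add_le x ((-1 : ℝ) • x)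
  have h2 := h.smul_eq (-1) x
  have h0 := (h.eq_zero_iff 0).2 rfl
  have h3 : x + (-1 : ℝ) • x = 0 := by rw [neg_one_smul, add_neg_cancel]
  rw [h3, h0, h2] at h1
  norm_num at h1
  linarith

lemma wcore (h : IsNorm τ) : NormedSpace.Core ℝ (W τ h) where
  norm_nonneg x := tau_nonneg h x
  norm_smul c x := h.smul_eq c x
  norm_triangle x y := h.add_le x y
  norm_eq_zero_iff x := h.eq_zero_iff x

noncomputable instance : NormedAddCommGroup (W τ h) := NormedAddCommGroup.ofCore (wcore h)
noncomputable instance : NormedSpace ℝ (W τ h) := NormedSpace.ofCore (wcore h)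
noncomputable instance : MeasurableSpace (W τ h) := borel _
instance : BorelSpace (W τ h) := ⟨rfl⟩

def eqv (h : IsNorm τ) : P2 ≃ₗ[ℝ] W τ h := LinearEquiv.refl ℝ P2

lemma norm_eqv (h : IsNorm τ) (x : P2) : ‖eqv h x‖ = τ x := rfl

lemma ediam_eqv (h : IsNorm τ) (A : Set P2) : Metric.ediam (eqv h '' A) = tauDiam τ A := by
  simp only [Metric.ediam, tauDiam, iSup_image]
  simp only [edist_dist, dist_eq_norm, ← map_sub, norm_eqv]

lemma tauLen_eq (h : IsNorm τ) (S : Set P2) : tauLen τ S = μH[1] (eqv h '' S) := by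
  rw [hausdorffMeasure_apply]
  have hsum : ∀ s : Set (W τ h), (⨆ _ : s.Nonempty, Metric.ediam s ^ (1 : ℝ)) = Metric.ediam s := by
    intro s
    rcases s.eq_empty_or_nonempty with rfl | hs
    · simp
    · simp [hs]
  simp only [hsum]
  apply le_antisymm
  · refine iSup₂_le fun ε hε => ?_
    refine le_iSup₂_of_le (ENNReal.ofReal ε) (ENNReal.ofReal_pos.2 hε) ?_
    refine le_iInf fun t => le_iInf fun hts => le_iInf fun ht => ?_
    have himg : ∀ i, eqv h '' (eqv h ⁻¹' t i) = t i := fun i =>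
      image_preimage_eq _ (eqv h).surjective
    have hd : ∀ i, tauDiam τ (eqv h ⁻¹' t i) = Metric.ediam (t i) := fun i => by
      rw [← ediam_eqv h, himg]
    refine iInf_le_of_le (fun i => eqv h ⁻¹' t i) (iInf_le_of_le ?_ (iInf_le_of_le ?_ ?_))
    · rw [← preimage_iUnion]; exact image_subset_iff.1 hts
    · intro i; rw [hd]; exact ht i
    · simp only [hd]; exact le_rfl
  · refine iSup₂_le fun r hr => ?_
    obtain ⟨ε, hε, hεr⟩ : ∃ ε : ℝ, 0 < ε ∧ ENNReal.ofReal ε ≤ r := by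
      rcases eq_or_ne r ∞ with rfl | hr'
      · exact ⟨1, one_pos, le_top⟩
      · exact ⟨r.toReal, ENNReal.toReal_pos hr.ne' hr', ENNReal.ofReal_toReal_le⟩
    refine le_iSup₂_of_le ε hε ?_
    refine le_iInf fun A => le_iInf fun hA => le_iInf fun hd => ?_
    refine iInf_le_of_le (fun i => eqv h '' A i) (iInf_le_of_le ?_ (iInf_le_of_le ?_ ?_))
    · rw [← image_iUnion]; exact image_mono hA
    · intro i; rw [ediam_eqv]; exact (hd i).trans hεr
    · simp only [ediam_eqv]; exact le_rfl

instance : FiniteDimensional ℝ (W τ h) := LinearEquiv.finiteDimensional (eqv h)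

end
end St16

/-- For a strictly convex norm `τ` and a nonempty finite `E ⊂ ℝ²`, any
compact connected set `T ⊇ E` of minimal one-dimensional `τ`-Hausdorff measure among all
compact connected sets containing `E` is contained in the closed convex hull of `E`. -/
theorem statement16 (τ : P2 → ℝ) (hτ : IsStrictlyConvexNorm τ) (E : Set P2)
    (hEfin : E.Finite) (hEne : E.Nonempty) (T : Set P2) (hTc : IsCompact T)
    (hTconn : IsConnected T) (hET : E ⊆ T)
    (hmin : ∀ T' : Set P2, IsCompact T' → IsConnected T' → E ⊆ T' →
      tauLen τ T ≤ tauLen τ T') :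
    T ⊆ closure (convexHull ℝ E) := by
  obtain ⟨h, hsc⟩ := hτ
  let L : P2 ≃L[ℝ] St16.W τ h := (St16.eqv h).toContinuousLinearEquiv
  have hL : ∀ S : Set P2, L '' S = St16.eqv h '' S := fun S => rfl
  have hlen : ∀ S : Set P2, tauLen τ S = MeasureTheory.Measure.hausdorffMeasure 1 (L '' S) :=
    fun S => St16.tauLen_eq h S
  have main := St16.abstract_main (V := St16.W τ h)
    (by rw [← (St16.eqv h).finrank_eq]; simp) (by
      intro x y hxy
      by_contra hcon
      exact (hsc ((St16.eqv h).symm x) ((St16.eqv h).symm y) hcon).ne hxy)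
    (L '' E) (hEfin.image _) (hEne.image _) (L '' T) (hTc.image L.continuous)
    (hTconn.image _ L.continuous.continuousOn) (Set.image_mono hET) (by
      intro T' h1 h2 h3
      have h4 := hmin (L.symm '' T') (h1.image L.symm.continuous)
        (h2.image _ L.symm.continuous.continuousOn) (by
          intro a ha
          exact ⟨L a, h3 ⟨a, ha, rfl⟩, L.symm_apply_apply a⟩)
      rw [hlen, hlen, ← Set.image_comp] at h4
      simpa using h4)
  intro p hp
  have h5 := main ⟨p, hp, rfl⟩
  have h6 : convexHull ℝ (L '' E) = L '' convexHull ℝ E :=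
    ((L : P2 →ₗ[ℝ] St16.W τ h).image_convexHull E).symm
  rw [h6, ← L.image_closure] at h5
  obtain ⟨q, hq, hqp⟩ := h5
  rwa [← L.injective hqp]
end
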